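/- arXiv:2605.06194 — 3 statements merged into one kernel-verified Lean document; each statement's English description precedes it below -/
import Mathlib

section
/- For n = 5 voters, every instance (c,k) is integralizable; equivalently, the committee election monoid M_R on five voters is integrally closed in Z^{|R|+1+n} (i.e., M_R = cone(M_R) ∩ Z^{|R|+1+n}). -/
/-- Candidate types: non-empty subsets of the voter set `Fin n`. -/
abbrev Typ (n : ℕ) := {S : Finset (Fin n) // S.Nonempty}

/-- Utility of voter `i` under an integral committee `x`. -/
def intUtil {n : ℕ} (x : Typ n → ℕ) (i : Fin n) : ℤ :=
  ∑ R : Typ n, if i ∈ R.1 then (x R : ℤ) else 0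

/-- Utility of voter `i` under a fractional committee `x`. -/
def fracUtil {n : ℕ} (x : Typ n → ℝ) (i : Fin n) : ℝ :=
  ∑ R : Typ n, if i ∈ R.1 then x R else 0

/-- `x` is an integral committee for the instance `(c, k)`. -/
def IsIntCommittee {n : ℕ} (c : Typ n → ℕ) (k : ℕ) (x : Typ n → ℕ) : Prop :=
  (∀ R, x R ≤ c R) ∧ (∑ R : Typ n, x R) ≤ k

/-- `x` is a fractional committee for the instance `(c, k)`. -/
def IsFracCommittee {n : ℕ} (c : Typ n → ℕ) (k : ℕ) (x : Typ n → ℝ) : Prop :=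
  (∀ R, 0 ≤ x R) ∧ (∀ R, x R ≤ (c R : ℝ)) ∧ (∑ R : Typ n, x R) ≤ (k : ℝ)

/-- `u` is integral-committee-feasible in `(c, k)`. -/
def IntFeasible {n : ℕ} (c : Typ n → ℕ) (k : ℕ) (u : Fin n → ℤ) : Prop :=
  ∃ x : Typ n → ℕ, IsIntCommittee c k x ∧ ∀ i, u i ≤ intUtil x i

/-- `u` is fractional-committee-feasible in `(c, k)`. -/
def FracFeasible {n : ℕ} (c : Typ n → ℕ) (k : ℕ) (u : Fin n → ℤ) : Prop :=
  ∃ x : Typ n → ℝ, IsFracCommittee c k x ∧ ∀ i, (u i : ℝ) ≤ fracUtil x i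

/-- `(c, k)` is integralizable. -/
def Integralizable {n : ℕ} (c : Typ n → ℕ) (k : ℕ) : Prop :=
  ∀ u : Fin n → ℤ, FracFeasible c k u → IntFeasible c k u

/-- Membership of `(c, k, u)` in the committee election monoid `M_R`:
`(c,k,u)` is a non-negative integer combination of the generators
`X_R = (e_R, 1, a_R)`, `Z_R = (e_R, 0, 0)`, `T = (0,1,0)`, `S_i = (0,0,-e_i)`. -/
def InMonoid {n : ℕ} (c : Typ n → ℤ) (k : ℤ) (u : Fin n → ℤ) : Prop :=
  ∃ (x z : Typ n → ℕ) (t : ℕ) (s : Fin n → ℕ),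
    (∀ R, c R = (x R : ℤ) + (z R : ℤ)) ∧
    (k = (∑ R : Typ n, (x R : ℤ)) + (t : ℤ)) ∧
    (∀ i, u i = (∑ R : Typ n, if i ∈ R.1 then (x R : ℤ) else 0) - (s i : ℤ))

/-- Membership of `(c, k, u)` in the real cone generated by the generators of
the committee election monoid. -/
def InCone {n : ℕ} (c : Typ n → ℤ) (k : ℤ) (u : Fin n → ℤ) : Prop :=
  ∃ (x z : Typ n → ℝ) (t : ℝ) (s : Fin n → ℝ),
    (∀ R, 0 ≤ x R) ∧ (∀ R, 0 ≤ z R) ∧ 0 ≤ t ∧ (∀ i, 0 ≤ s i) ∧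
    (∀ R, (c R : ℝ) = x R + z R) ∧
    ((k : ℝ) = (∑ R : Typ n, x R) + t) ∧
    (∀ i, (u i : ℝ) = (∑ R : Typ n, if i ∈ R.1 then x R else 0) - s i)

/-! ## A finite search certificate -/

/-- Number of the bits `0, …, m-1` set in `S`. -/
def popc : ℕ → ℕ → ℕ
  | 0, _ => 0
  | m + 1, S => popc m S + (S.testBit m).toNat

/-- A possible killer: a voter whose fractional candidates form the set `D` (a bit mask) and who
demands `r` of them.  `km` is the mask of the committees which it rejects, `cm` the mask of the
(indices of) entries which may occur together with it. -/
structure Entry where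
  idx : ℕ
  bit : ℕ
  D : ℕ
  r : ℕ
  km : ℕ
  cm : ℕ

/-- Branch over the admissible entries rejecting the committee with mask `jb`. -/
noncomputable def branch (rec : ℕ → ℕ → Bool) (jb K : ℕ) (l : List Entry) : ℕ → Bool :=
  List.rec (motive := fun _ => ℕ → Bool) (fun _ => true)
    (fun t _ ih A =>
      Bool.rec
        (Bool.rec
          (Bool.rec false (ih (Nat.xor A t.bit)) (rec (Nat.lor K t.km) (Nat.land A t.cm)))
          (ih A) (Nat.beq (Nat.land t.km jb) 0))
        (ih A) (Nat.beq (Nat.land A t.bit) 0)) l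

/-- Search: `true` means that no `n` admissible entries reject all committees outside `K`. -/
noncomputable def search (tab : List Entry) (full : ℕ) (n : ℕ) : ℕ → ℕ → Bool :=
  Nat.rec (motive := fun _ => ℕ → ℕ → Bool)
    (fun K _ => Bool.rec true false (Nat.beq (Nat.land (Nat.xor full K) full) 0))
    (fun _ ih K A =>
      Bool.rec (branch ih (Nat.land (Nat.land (Nat.succ K) (Nat.xor full K)) full) K tab A) false
        (Nat.beq (Nat.land (Nat.land (Nat.succ K) (Nat.xor full K)) full) 0)) n

/-- Whether `D` can have demand `r`. -/
def allowed (m k D r : ℕ) : Bool :=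
  if D = 0 then r == 0 else if D = 2 ^ m - 1 then decide (r ≤ k)
  else decide (r < popc m D) && decide (r < k)

/-- Upper bound for the weight of `S`. -/
def ubound (m k S : ℕ) : ℕ := min (popc m S) k

/-- Two demands which cannot occur together. -/
def conflict (m k : ℕ) (s t : Entry) : Bool :=
  decide (ubound m k (s.D ||| t.D) + ubound m k (s.D &&& t.D) < s.r + t.r) ||
  (decide (ubound m k (s.D ||| t.D) + ubound m k (s.D &&& t.D) = s.r + t.r) &&
    !((s.D ||| t.D) == 2 ^ m - 1 && (s.D &&& t.D) == 0))

/-- The entry table is correct. -/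
def tableOK (m k : ℕ) (ys : List ℕ) (tab : List Entry) : Bool :=
  ys.all (fun y => popc m y == k) &&
  (List.range (2 ^ m)).all (fun D => (List.range (k + 1)).all fun r =>
    !(allowed m k D r) || ys.all (fun y => decide (r ≤ popc m (D &&& y))) ||
      tab.any (fun t => t.D == D && t.r == r)) &&
  tab.all (fun t => decide (0 < t.D) && decide (t.D < 2 ^ m - 1) && t.bit == 2 ^ t.idx &&
    decide (t.idx < tab.length) &&
    (List.range ys.length).all fun j =>
      t.km.testBit j || decide (t.r ≤ popc m (t.D &&& ys.getD j 0))) &&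
  tab.all (fun s => tab.all fun t => s.cm.testBit t.idx || conflict m k s t) &&
  decide ((tab.map Entry.idx).Nodup)

/-! ## Soundness of the search -/

theorem land_two_pow_eq_zero {A i : ℕ} (h : Nat.beq (Nat.land A (2 ^ i)) 0 = true) :
    A.testBit i = false := by
  have h1 : A &&& 2 ^ i = 0 := Nat.eq_of_beq_eq_true h
  have h2 : (A &&& 2 ^ i).testBit i = false := by rw [h1]; simp
  simpa using h2

theorem land_eq_zero_testBit {a b j : ℕ} (h : Nat.beq (Nat.land a b) 0 = true)
    (hb : b.testBit j = true) : a.testBit j = false := by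
  have h1 : a &&& b = 0 := Nat.eq_of_beq_eq_true h
  have h2 : (a &&& b).testBit j = false := by rw [h1]; simp
  simpa [hb] using h2

/-- The entries in `V` reject all committees outside `K`. -/
def Covers (N : ℕ) (V : Finset Entry) (K : ℕ) : Prop :=
  ∀ j < N, K.testBit j = true ∨ ∃ v ∈ V, v.km.testBit j = true

/-- `V` is an admissible set of entries. -/
def Adm (tab : List Entry) (A : ℕ) (V : Finset Entry) : Prop :=
  (∀ v ∈ V, v ∈ tab) ∧ (∀ v ∈ V, A.testBit v.idx = true) ∧
    ∀ v ∈ V, ∀ w ∈ V, v ≠ w → v.cm.testBit w.idx = true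

open Classical in
theorem branch_sound (tab : List Entry) (N n : ℕ)
    (hbit : ∀ t ∈ tab, t.bit = 2 ^ t.idx)
    (hinj : ∀ s ∈ tab, ∀ t ∈ tab, s.idx = t.idx → s = t)
    (rec : ℕ → ℕ → Bool)
    (hrec : ∀ K A, rec K A = true → ∀ V, Adm tab A V → V.card ≤ n → ¬ Covers N V K)
    (jb K j : ℕ) (hj : jb.testBit j = true) (l : List Entry) (hl : ∀ t ∈ l, t ∈ tab) :
    ∀ A, branch rec jb K l A = true → ∀ V, Adm tab A V → V.card ≤ n + 1 →
      (∃ t ∈ V, t ∈ l ∧ t.km.testBit j = true) → ¬ Covers N V K := by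
  induction l with
  | nil => rintro A - V - - ⟨t, -, ht, -⟩; simp at ht
  | cons t ts ih =>
    have ih' := ih (fun s hs => hl s (List.mem_cons_of_mem _ hs))
    have htt : t ∈ tab := hl t List.mem_cons_self
    intro A hA V hV hc ⟨w, hwV, hwl, hwj⟩
    have hdef : branch rec jb K (t :: ts) A =
      Bool.rec
        (Bool.rec
          (Bool.rec false (branch rec jb K ts (Nat.xor A t.bit))
            (rec (Nat.lor K t.km) (Nat.land A t.cm)))
          (branch rec jb K ts A) (Nat.beq (Nat.land t.km jb) 0))
        (branch rec jb K ts A) (Nat.beq (Nat.land A t.bit) 0) := rfl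
    rw [hdef] at hA
    by_cases htV : t ∈ V ∧ t.km.testBit j = true
    · obtain ⟨htV, htj⟩ := htV
      cases h1 : Nat.beq (Nat.land A t.bit) 0 with
      | true =>
        rw [hbit t htt] at h1
        have := land_two_pow_eq_zero h1
        rw [hV.2.1 t htV] at this
        exact absurd this (by simp)
      | false =>
        cases h2 : Nat.beq (Nat.land t.km jb) 0 with
        | true =>
          have := land_eq_zero_testBit h2 hj
          rw [htj] at this
          exact absurd this (by simp)
        | false =>
          rw [h1, h2] at hA
          cases h3 : rec (Nat.lor K t.km) (Nat.land A t.cm) with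
          | false => rw [h3] at hA; exact absurd hA (by simp)
          | true =>
            intro hcov
            refine hrec _ _ h3 (V.erase t) ⟨?_, ?_, ?_⟩ ?_ ?_
            · intro v hv; exact hV.1 v (Finset.mem_of_mem_erase hv)
            · intro v hv
              have hv' := Finset.mem_of_mem_erase hv
              have e1 := hV.2.1 v hv'
              have e2 := hV.2.2 t htV v hv' (Finset.ne_of_mem_erase hv).symm
              change (A &&& t.cm).testBit v.idx = true
              rw [Nat.testBit_and, e1, e2]; rfl
            · intro v hv w hw hne
              exact hV.2.2 v (Finset.mem_of_mem_erase hv) w (Finset.mem_of_mem_erase hw) hne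
            · rw [Finset.card_erase_of_mem htV]; omega
            · intro i hi
              change (K ||| t.km).testBit i = true ∨ _
              rw [Nat.testBit_or]
              rcases hcov i hi with h | ⟨v, hv, hvi⟩
              · left; simp [h]
              · by_cases hvt : v = t
                · left; subst hvt; simp [hvi]
                · right; exact ⟨v, Finset.mem_erase.2 ⟨hvt, hv⟩, hvi⟩
    · have hwt : w ≠ t := by rintro rfl; exact htV ⟨hwV, hwj⟩
      have hwts : w ∈ ts := by
        rcases List.mem_cons.1 hwl with h | h
        · exact absurd h hwt
        · exact h
      cases h1 : Nat.beq (Nat.land A t.bit) 0 with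
      | true => rw [h1] at hA; exact ih' A hA V hV hc ⟨w, hwV, hwts, hwj⟩
      | false =>
        cases h2 : Nat.beq (Nat.land t.km jb) 0 with
        | true => rw [h1, h2] at hA; exact ih' A hA V hV hc ⟨w, hwV, hwts, hwj⟩
        | false =>
          rw [h1, h2] at hA
          cases h3 : rec (Nat.lor K t.km) (Nat.land A t.cm) with
          | false => rw [h3] at hA; exact absurd hA (by simp)
          | true =>
            rw [h3] at hA
            intro hcov
            by_cases htV' : t ∈ V
            · -- `t` occurs
              refine hrec _ _ h3 (V.erase t) ⟨?_, ?_, ?_⟩ ?_ ?_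
              · intro v hv; exact hV.1 v (Finset.mem_of_mem_erase hv)
              · intro v hv
                have hv' := Finset.mem_of_mem_erase hv
                have e1 := hV.2.1 v hv'
                have e2 := hV.2.2 t htV' v hv' (Finset.ne_of_mem_erase hv).symm
                change (A &&& t.cm).testBit v.idx = true
                rw [Nat.testBit_and, e1, e2]; rfl
              · intro v hv w hw hne
                exact hV.2.2 v (Finset.mem_of_mem_erase hv) w (Finset.mem_of_mem_erase hw) hne
              · rw [Finset.card_erase_of_mem htV']; omega
              · intro i hi
                change (K ||| t.km).testBit i = true ∨ _
                rw [Nat.testBit_or]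
                rcases hcov i hi with h | ⟨v, hv, hvi⟩
                · left; simp [h]
                · by_cases hvt : v = t
                  · left; subst hvt; simp [hvi]
                  · right; exact ⟨v, Finset.mem_erase.2 ⟨hvt, hv⟩, hvi⟩
            · refine ih' _ hA V ⟨hV.1, ?_, hV.2.2⟩ hc ⟨w, hwV, hwts, hwj⟩ hcov
              intro v hv
              have hne : t.idx ≠ v.idx := by
                intro h
                have := hinj t htt v (hV.1 v hv) h
                rw [this] at htV'
                exact htV' hv
              change (A ^^^ t.bit).testBit v.idx = true
              rw [hbit t htt, Nat.testBit_xor, hV.2.1 v hv, Nat.testBit_two_pow]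
              simp [hne]

theorem search_sound (tab : List Entry) (N : ℕ)
    (hbit : ∀ t ∈ tab, t.bit = 2 ^ t.idx)
    (hinj : ∀ s ∈ tab, ∀ t ∈ tab, s.idx = t.idx → s = t) (n : ℕ) :
    ∀ K A, search tab (2 ^ N - 1) n K A = true → ∀ V, Adm tab A V → V.card ≤ n →
      ¬ Covers N V K := by
  induction n with
  | zero =>
    intro K A h V hV hc hcov
    have hV0 : V = ∅ := Finset.card_eq_zero.1 (by omega)
    subst hV0
    have hdef : search tab (2 ^ N - 1) 0 K A =
      Bool.rec true false (Nat.beq (Nat.land (Nat.xor (2 ^ N - 1) K) (2 ^ N - 1)) 0) := rfl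
    rw [hdef] at h
    cases h1 : Nat.beq (Nat.land (Nat.xor (2 ^ N - 1) K) (2 ^ N - 1)) 0 with
    | true => rw [h1] at h; exact absurd h (by simp)
    | false =>
      have h2 : ((2 ^ N - 1) ^^^ K) &&& (2 ^ N - 1) = 0 := by
        apply Nat.eq_of_testBit_eq
        intro i
        rw [Nat.testBit_and, Nat.testBit_xor, Nat.testBit_two_pow_sub_one, Nat.zero_testBit]
        by_cases hi : i < N
        · rcases hcov i hi with h | ⟨v, hv, -⟩
          · simp [h, hi]
          · simp at hv
        · simp [hi]
      have h3 : Nat.beq (((2 ^ N - 1) ^^^ K) &&& (2 ^ N - 1)) 0 = false := h1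
      rw [h2] at h3
      exact absurd h3 (by simp)
  | succ n ih =>
    intro K A h V hV hc hcov
    set jb := Nat.land (Nat.land (Nat.succ K) (Nat.xor (2 ^ N - 1) K)) (2 ^ N - 1) with hjb
    have hdef : search tab (2 ^ N - 1) (n + 1) K A =
      Bool.rec (branch (search tab (2 ^ N - 1) n) jb K tab A) false (Nat.beq jb 0) := rfl
    rw [hdef] at h
    cases h1 : Nat.beq jb 0 with
    | true => rw [h1] at h; exact absurd h (by simp)
    | false =>
      rw [h1] at h
      have h0 : jb ≠ 0 := by
        intro h0; rw [h0] at h1; exact absurd h1 (by simp)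
      obtain ⟨j, hj⟩ := Nat.exists_testBit_of_ne_zero h0
      have hj2 : ((Nat.succ K &&& ((2 ^ N - 1) ^^^ K)) &&& (2 ^ N - 1)).testBit j = true := hj
      rw [Nat.testBit_and, Nat.testBit_and, Nat.testBit_xor, Nat.testBit_two_pow_sub_one] at hj2
      simp only [Bool.and_eq_true, decide_eq_true_eq] at hj2
      obtain ⟨⟨-, hx⟩, hjN⟩ := hj2
      have hK : K.testBit j = false := by simpa [hjN] using hx
      rcases hcov j hjN with h' | ⟨v, hv, hvj⟩
      · rw [hK] at h'; exact absurd h' (by simp)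
      · exact branch_sound tab N n hbit hinj _ ih jb K j hj tab (fun _ h => h) A h V hV hc
          ⟨v, hv, hV.1 v hv, hvj⟩ hcov

/-! ## Real weights -/

/-- The weight of the set with mask `S`. -/
noncomputable def fs (m : ℕ) (f : ℕ → ℝ) (S : ℕ) : ℝ :=
  ∑ e ∈ Finset.range m, if S.testBit e then f e else 0

theorem popc_eq (m S : ℕ) : popc m S = ∑ e ∈ Finset.range m, if S.testBit e then 1 else 0 := by
  induction m with
  | zero => rfl
  | succ m ih =>
    rw [Finset.sum_range_succ, ← ih]
    change popc m S + (S.testBit m).toNat = _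
    cases S.testBit m <;> rfl

theorem fs_or_add_and (m : ℕ) (f : ℕ → ℝ) (S T : ℕ) :
    fs m f (S ||| T) + fs m f (S &&& T) = fs m f S + fs m f T := by
  unfold fs
  rw [← Finset.sum_add_distrib, ← Finset.sum_add_distrib]
  refine Finset.sum_congr rfl fun e _ => ?_
  rw [Nat.testBit_or, Nat.testBit_and]
  cases S.testBit e <;> cases T.testBit e <;> simp

theorem exists_bit {m S : ℕ} (hS : S < 2 ^ m) (h0 : S ≠ 0) :
    ∃ e ∈ Finset.range m, S.testBit e = true := by
  obtain ⟨e, he⟩ := Nat.exists_testBit_of_ne_zero h0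
  refine ⟨e, ?_, he⟩
  rw [Finset.mem_range]
  by_contra h
  rw [Nat.testBit_lt_two_pow (lt_of_lt_of_le hS (Nat.pow_le_pow_right (by norm_num) (by omega)))]
    at he
  exact absurd he (by simp)

theorem exists_nbit {m S : ℕ} (hS : S < 2 ^ m) (h0 : S ≠ 2 ^ m - 1) :
    ∃ e ∈ Finset.range m, S.testBit e = false := by
  by_contra! h
  apply h0
  apply Nat.eq_of_testBit_eq
  intro i
  rw [Nat.testBit_two_pow_sub_one]
  by_cases hi : i < m
  · simpa [hi] using h i (Finset.mem_range.2 hi)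
  · rw [Nat.testBit_lt_two_pow
      (lt_of_lt_of_le hS (Nat.pow_le_pow_right (by norm_num) (by omega)))]
    simp [hi]

section
variable {m k : ℕ} {f : ℕ → ℝ}

theorem fs_zero : fs m f 0 = 0 := by simp [fs]

theorem fs_full (hk : ∑ e ∈ Finset.range m, f e = k) : fs m f (2 ^ m - 1) = k := by
  rw [← hk]
  refine Finset.sum_congr rfl fun e he => ?_
  rw [Nat.testBit_two_pow_sub_one]
  simp [Finset.mem_range.1 he]

theorem fs_le_popc (hf : ∀ e < m, 0 < f e ∧ f e < 1) (S : ℕ) : fs m f S ≤ popc m S := by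
  rw [popc_eq]
  push_cast
  refine Finset.sum_le_sum fun e he => ?_
  have := hf e (Finset.mem_range.1 he)
  split_ifs <;> linarith

theorem fs_lt_popc (hf : ∀ e < m, 0 < f e ∧ f e < 1) {S : ℕ} (hS : S < 2 ^ m) (h0 : S ≠ 0) :
    fs m f S < popc m S := by
  rw [popc_eq]
  push_cast
  obtain ⟨e, he, hb⟩ := exists_bit hS h0
  refine Finset.sum_lt_sum (fun e he => ?_) ⟨e, he, ?_⟩
  · have := hf e (Finset.mem_range.1 he)
    split_ifs <;> linarith
  · have := hf e (Finset.mem_range.1 he)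
    simp [hb, this.2]

theorem fs_le_k (hf : ∀ e < m, 0 < f e ∧ f e < 1) (hk : ∑ e ∈ Finset.range m, f e = k) (S : ℕ) :
    fs m f S ≤ k := by
  rw [← hk]
  refine Finset.sum_le_sum fun e he => ?_
  have := hf e (Finset.mem_range.1 he)
  split_ifs <;> linarith

theorem fs_lt_k (hf : ∀ e < m, 0 < f e ∧ f e < 1) (hk : ∑ e ∈ Finset.range m, f e = k) {S : ℕ}
    (hS : S < 2 ^ m) (h0 : S ≠ 2 ^ m - 1) : fs m f S < k := by
  rw [← hk]
  obtain ⟨e, he, hb⟩ := exists_nbit hS h0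
  refine Finset.sum_lt_sum (fun e he => ?_) ⟨e, he, ?_⟩
  · have := hf e (Finset.mem_range.1 he)
    split_ifs <;> linarith
  · have := hf e (Finset.mem_range.1 he)
    simp [hb, this.1]

theorem fs_nonneg (hf : ∀ e < m, 0 < f e ∧ f e < 1) (S : ℕ) : 0 ≤ fs m f S := by
  refine Finset.sum_nonneg fun e he => ?_
  have := hf e (Finset.mem_range.1 he)
  split_ifs <;> linarith

theorem fs_le_ubound (hf : ∀ e < m, 0 < f e ∧ f e < 1) (hk : ∑ e ∈ Finset.range m, f e = k)
    (S : ℕ) : fs m f S ≤ ubound m k S := by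
  unfold ubound
  rw [Nat.cast_min]
  exact le_min (fs_le_popc hf S) (fs_le_k hf hk S)

theorem fs_lt_ubound (hf : ∀ e < m, 0 < f e ∧ f e < 1) (hk : ∑ e ∈ Finset.range m, f e = k)
    {S : ℕ} (hS : S < 2 ^ m) (h0 : S ≠ 0) (h1 : S ≠ 2 ^ m - 1) : fs m f S < ubound m k S := by
  unfold ubound
  rw [Nat.cast_min]
  exact lt_min (fs_lt_popc hf hS h0) (fs_lt_k hf hk hS h1)

/-- Conflicting demands do not occur together. -/
theorem not_conflict (hf : ∀ e < m, 0 < f e ∧ f e < 1) (hk : ∑ e ∈ Finset.range m, f e = k)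
    (s t : Entry) (hs : s.D < 2 ^ m) (ht : t.D < 2 ^ m)
    (hsr : (s.r : ℝ) ≤ fs m f s.D) (htr : (t.r : ℝ) ≤ fs m f t.D)
    (hs0 : s.D ≠ 0) (hs1 : s.D ≠ 2 ^ m - 1) :
    conflict m k s t = false := by
  have e := fs_or_add_and m f s.D t.D
  have hU : (s.D ||| t.D) < 2 ^ m := Nat.or_lt_two_pow hs ht
  have hI : (s.D &&& t.D) < 2 ^ m := Nat.and_lt_two_pow _ ht
  have bU := fs_le_ubound hf hk (s.D ||| t.D)
  have bI := fs_le_ubound hf hk (s.D &&& t.D)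
  unfold conflict
  rw [Bool.or_eq_false_iff]
  constructor
  · rw [decide_eq_false_iff_not]
    intro h
    have h' : ((ubound m k (s.D ||| t.D) : ℝ) + ubound m k (s.D &&& t.D)) < s.r + t.r := by
      exact_mod_cast h
    linarith
  · by_contra hc
    rw [Bool.not_eq_false] at hc
    simp only [Bool.and_eq_true, decide_eq_true_eq, Bool.not_eq_true',
      Bool.and_eq_false_iff, beq_eq_false_iff_ne] at hc
    obtain ⟨h, hne⟩ := hc
    have h' : ((ubound m k (s.D ||| t.D) : ℝ) + ubound m k (s.D &&& t.D)) = s.r + t.r := by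
      exact_mod_cast h
    have hU0 : (s.D ||| t.D) ≠ 0 := by
      intro h0; exact hs0 (Nat.or_eq_zero_iff.1 h0).1
    have hI1 : (s.D &&& t.D) ≠ 2 ^ m - 1 := by
      intro h0
      have : s.D &&& t.D ≤ s.D := Nat.and_le_left
      omega
    rcases hne with hne | hne
    · have := fs_lt_ubound hf hk hU hU0 hne
      linarith
    · have := fs_lt_ubound hf hk hI hne hI1
      linarith

/-- The rounding lemma, from a certificate. -/
theorem rounding_of_cert (ys : List ℕ) (tab : List Entry)
    (hok : tableOK m k ys tab = true)
    (hsearch : search tab (2 ^ ys.length - 1) 5 0 (2 ^ tab.length - 1) = true)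
    (hf : ∀ e < m, 0 < f e ∧ f e < 1) (hk : ∑ e ∈ Finset.range m, f e = k)
    (D : Fin 5 → ℕ) (hD : ∀ i, D i < 2 ^ m) :
    ∃ y : ℕ, popc m y = k ∧ ∀ i (t : ℤ), (t : ℝ) ≤ fs m f (D i) → t ≤ popc m (D i &&& y) := by
  classical
  unfold tableOK at hok
  simp only [Bool.and_eq_true, List.all_eq_true, decide_eq_true_eq, Bool.or_eq_true,
    beq_iff_eq, List.any_eq_true, List.mem_range, Bool.not_eq_true'] at hok
  obtain ⟨⟨⟨⟨h1, h2⟩, h3⟩, h4⟩, h5⟩ := hok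
  have hinj : ∀ s ∈ tab, ∀ t ∈ tab, s.idx = t.idx → s = t :=
    fun s hs t ht h => List.inj_on_of_nodup_map h5 hs ht h
  set r : Fin 5 → ℕ := fun i => ⌊fs m f (D i)⌋₊ with hr
  have hrle : ∀ i, (r i : ℝ) ≤ fs m f (D i) := fun i => Nat.floor_le (fs_nonneg hf _)
  have hrk : ∀ i, r i ≤ k := fun i => by
    have := (hrle i).trans (fs_le_k hf hk (D i))
    exact_mod_cast this
  have hall : ∀ i, allowed m k (D i) (r i) = true := by
    intro i
    unfold allowed
    split_ifs with a b
    · have := hrle i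
      rw [a, fs_zero] at this
      have : r i = 0 := by
        have h' : r i ≤ 0 := by exact_mod_cast this
        omega
      simp [this]
    · simpa using hrk i
    · have c1 := (hrle i).trans_lt (fs_lt_popc hf (hD i) a)
      have c2 := (hrle i).trans_lt (fs_lt_k hf hk (hD i) b)
      have c1' : r i < popc m (D i) := by exact_mod_cast c1
      have c2' : r i < k := by exact_mod_cast c2
      simp [c1', c2']
  have : Nonempty Entry := ⟨⟨0, 0, 0, 0, 0, 0⟩⟩
  have hex : ∀ i : Fin 5, ¬ (∀ y ∈ ys, r i ≤ popc m (D i &&& y)) →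
      ∃ t : Entry, t ∈ tab ∧ t.D = D i ∧ t.r = r i := by
    intro i hi
    rcases h2 (D i) (hD i) (r i) (Nat.lt_succ_of_le (hrk i)) with (h | h) | ⟨t, h, h'⟩
    · rw [hall i] at h; exact absurd h (by simp)
    · exact absurd h hi
    · exact ⟨t, h, h'⟩
  choose! g hg using hex
  let P : Finset (Fin 5) := Finset.univ.filter fun i => ¬ (∀ y ∈ ys, r i ≤ popc m (D i &&& y))
  have hP : ∀ i ∈ P, g i ∈ tab ∧ (g i).D = D i ∧ (g i).r = r i :=
    fun i hi => hg i (Finset.mem_filter.1 hi).2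
  let V : Finset Entry := P.image g
  have hVcard : V.card ≤ 5 := by
    refine Finset.card_image_le.trans ((Finset.card_le_univ P).trans ?_)
    simp
  have hV : ∀ v ∈ V, v ∈ tab ∧ (v.r : ℝ) ≤ fs m f v.D := by
    intro v hv
    obtain ⟨i, hi, rfl⟩ := Finset.mem_image.1 hv
    obtain ⟨a, b, c⟩ := hP i hi
    refine ⟨a, ?_⟩
    rw [b, c]
    exact hrle i
  have hadm : Adm tab (2 ^ tab.length - 1) V := by
    refine ⟨fun v hv => (hV v hv).1, fun v hv => ?_, fun v hv w hw _ => ?_⟩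
    · rw [Nat.testBit_two_pow_sub_one]
      simpa using (h3 v (hV v hv).1).1.2
    · obtain ⟨v1, v2⟩ := hV v hv
      obtain ⟨w1, w2⟩ := hV w hw
      have e1 := (h3 v v1).1.1.1
      have e2 := (h3 w w1).1.1.1
      rcases h4 v v1 w w1 with h | h
      · exact h
      · rw [not_conflict hf hk v w (by omega) (by omega) v2 w2 (by omega) (by omega)] at h
        exact absurd h (by simp)
  have hnc := search_sound tab ys.length (fun t ht => (h3 t ht).1.1.2) hinj 5 _ _ hsearch V hadm
    hVcard
  unfold Covers at hnc
  push Not at hnc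
  obtain ⟨j, hj, -, hjV⟩ := hnc
  have hyj : ys.getD j 0 ∈ ys := by
    rw [List.getD_eq_getElem _ _ hj]; exact List.getElem_mem hj
  refine ⟨ys.getD j 0, h1 _ hyj, fun i t ht => ?_⟩
  have key : r i ≤ popc m (D i &&& ys.getD j 0) := by
    by_cases hi : i ∈ P
    · obtain ⟨a, b, c⟩ := hP i hi
      rcases (h3 _ a).2 j hj with h | h
      · exact absurd h (by simpa using hjV (g i) (Finset.mem_image_of_mem g hi))
      · rwa [b, c] at h
    · have : ∀ y ∈ ys, r i ≤ popc m (D i &&& y) := by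
        by_contra hcon
        exact hi (Finset.mem_filter.2 ⟨Finset.mem_univ _, hcon⟩)
      exact this _ hyj
  have ht' : t ≤ (r i : ℤ) := by
    rw [hr, Int.natCast_floor_eq_floor (fs_nonneg hf _)]
    exact Int.le_floor.2 ht
  exact ht'.trans (by exact_mod_cast key)

end

/-- The `1`-subsets of `2` elements. -/
def ys21 : List ℕ :=
  [1, 2]

theorem ok21 : tableOK 2 1 ys21 [] = true := by decide +kernel

theorem sr21 : search [] (2 ^ 2 - 1) 5 0 (2 ^ 0 - 1) = true := by
  decide +kernel

/-- The `1`-subsets of `3` elements. -/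
def ys31 : List ℕ :=
  [1, 2, 4]

theorem ok31 : tableOK 3 1 ys31 [] = true := by decide +kernel

theorem sr31 : search [] (2 ^ 3 - 1) 5 0 (2 ^ 0 - 1) = true := by
  decide +kernel

/-- The `2`-subsets of `3` elements. -/
def ys32 : List ℕ :=
  [3, 5, 6]

theorem ok32 : tableOK 3 2 ys32 [] = true := by decide +kernel

theorem sr32 : search [] (2 ^ 3 - 1) 5 0 (2 ^ 0 - 1) = true := by
  decide +kernel

/-- The `1`-subsets of `4` elements. -/
def ys41 : List ℕ :=
  [1, 2, 4, 8]

theorem ok41 : tableOK 4 1 ys41 [] = true := by decide +kernel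

theorem sr41 : search [] (2 ^ 4 - 1) 5 0 (2 ^ 0 - 1) = true := by
  decide +kernel

/-- The `2`-subsets of `4` elements. -/
def ys42 : List ℕ :=
  [3, 5, 6, 9, 10, 12]

/-- Killer table for `4` fractional candidates of total weight `2`. -/
def tab42 : List Entry :=
  [⟨0, 1, 3, 1, 32, 63⟩, ⟨1, 2, 5, 1, 16, 63⟩, ⟨2, 4, 6, 1, 8, 63⟩, ⟨3, 8, 9, 1, 4, 63⟩,
   ⟨4, 16, 10, 1, 2, 63⟩, ⟨5, 32, 12, 1, 1, 63⟩]

theorem ok42 : tableOK 4 2 ys42 tab42 = true := by decide +kernel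

theorem sr42 : search tab42 (2 ^ 6 - 1) 5 0 (2 ^ 6 - 1) = true := by
  decide +kernel

/-- The `3`-subsets of `4` elements. -/
def ys43 : List ℕ :=
  [7, 11, 13, 14]

theorem ok43 : tableOK 4 3 ys43 [] = true := by decide +kernel

theorem sr43 : search [] (2 ^ 4 - 1) 5 0 (2 ^ 0 - 1) = true := by
  decide +kernel

/-- The `1`-subsets of `5` elements. -/
def ys51 : List ℕ :=
  [1, 2, 4, 8, 16]

theorem ok51 : tableOK 5 1 ys51 [] = true := by decide +kernel

theorem sr51 : search [] (2 ^ 5 - 1) 5 0 (2 ^ 0 - 1) = true := by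
  decide +kernel

/-- The `2`-subsets of `5` elements. -/
def ys52 : List ℕ :=
  [3, 5, 6, 9, 10, 12, 17, 18, 20, 24]

/-- Killer table for `5` fractional candidates of total weight `2`. -/
def tab52 : List Entry :=
  [⟨0, 1, 3, 1, 800, 1047775⟩, ⟨1, 2, 5, 1, 656, 1047919⟩, ⟨2, 4, 6, 1, 584, 1047991⟩,
   ⟨3, 8, 9, 1, 388, 1048187⟩, ⟨4, 16, 10, 1, 322, 1048253⟩, ⟨5, 32, 12, 1, 193, 1048382⟩,
   ⟨6, 64, 17, 1, 52, 1048523⟩, ⟨7, 128, 18, 1, 42, 1048533⟩, ⟨8, 256, 20, 1, 25, 1048550⟩,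
   ⟨9, 512, 24, 1, 7, 1048568⟩, ⟨10, 1024, 7, 1, 512, 1048575⟩,
   ⟨11, 2048, 11, 1, 256, 1048575⟩, ⟨12, 4096, 13, 1, 128, 1048575⟩,
   ⟨13, 8192, 14, 1, 64, 1048575⟩, ⟨14, 16384, 19, 1, 32, 1048575⟩,
   ⟨15, 32768, 21, 1, 16, 1048575⟩, ⟨16, 65536, 22, 1, 8, 1048575⟩,
   ⟨17, 131072, 25, 1, 4, 1048575⟩, ⟨18, 262144, 26, 1, 2, 1048575⟩,
   ⟨19, 524288, 28, 1, 1, 1048575⟩]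

theorem ok52 : tableOK 5 2 ys52 tab52 = true := by decide +kernel

theorem sr52 : search tab52 (2 ^ 10 - 1) 5 0 (2 ^ 20 - 1) = true := by
  decide +kernel

/-- The `3`-subsets of `5` elements. -/
def ys53 : List ℕ :=
  [7, 11, 13, 14, 19, 21, 22, 25, 26, 28]

/-- Killer table for `5` fractional candidates of total weight `3`. -/
def tab53 : List Entry :=
  [⟨0, 1, 7, 2, 896, 1047679⟩, ⟨1, 2, 11, 2, 608, 1047967⟩, ⟨2, 4, 13, 2, 336, 1048239⟩,
   ⟨3, 8, 14, 2, 176, 1048399⟩, ⟨4, 16, 19, 2, 524, 1048051⟩, ⟨5, 32, 21, 2, 266, 1048309⟩,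
   ⟨6, 64, 22, 2, 134, 1048441⟩, ⟨7, 128, 25, 2, 73, 1048502⟩, ⟨8, 256, 26, 2, 37, 1048538⟩,
   ⟨9, 512, 28, 2, 19, 1048556⟩, ⟨10, 1024, 3, 1, 512, 1048575⟩,
   ⟨11, 2048, 5, 1, 256, 1048575⟩, ⟨12, 4096, 6, 1, 128, 1048575⟩,
   ⟨13, 8192, 9, 1, 64, 1048575⟩, ⟨14, 16384, 10, 1, 32, 1048575⟩,
   ⟨15, 32768, 12, 1, 16, 1048575⟩, ⟨16, 65536, 17, 1, 8, 1048575⟩,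
   ⟨17, 131072, 18, 1, 4, 1048575⟩, ⟨18, 262144, 20, 1, 2, 1048575⟩,
   ⟨19, 524288, 24, 1, 1, 1048575⟩]

theorem ok53 : tableOK 5 3 ys53 tab53 = true := by decide +kernel

theorem sr53 : search tab53 (2 ^ 10 - 1) 5 0 (2 ^ 20 - 1) = true := by
  decide +kernel

/-- The `4`-subsets of `5` elements. -/
def ys54 : List ℕ :=
  [15, 23, 27, 29, 30]

theorem ok54 : tableOK 5 4 ys54 [] = true := by decide +kernel

theorem sr54 : search [] (2 ^ 5 - 1) 5 0 (2 ^ 0 - 1) = true := by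
  decide +kernel

/-- The `1`-subsets of `6` elements. -/
def ys61 : List ℕ :=
  [1, 2, 4, 8, 16, 32]

theorem ok61 : tableOK 6 1 ys61 [] = true := by decide +kernel

theorem sr61 : search [] (2 ^ 6 - 1) 5 0 (2 ^ 0 - 1) = true := by
  decide +kernel

/-- The `2`-subsets of `6` elements. -/
def ys62 : List ℕ :=
  [3, 5, 6, 9, 10, 12, 17, 18, 20, 24, 33, 34, 36, 40, 48]

/-- Killer table for `6` fractional candidates of total weight `2`. -/
def tab62 : List Entry :=
  [⟨0, 1, 3, 1, 29472, 1125873046490335⟩, ⟨1, 2, 5, 1, 27280, 1125877886719343⟩,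
   ⟨2, 4, 6, 1, 26184, 1125880306833847⟩, ⟨3, 8, 9, 1, 22916, 1125886885602939⟩,
   ⟨4, 16, 10, 1, 21826, 1125889101245117⟩, ⟨5, 32, 12, 1, 19649, 1125893430293310⟩,
   ⟨6, 64, 17, 1, 14388, 1125898161735627⟩, ⟨7, 128, 18, 1, 13354, 1125898497412053⟩,
   ⟨8, 256, 20, 1, 11289, 1125899067904998⟩, ⟨9, 512, 24, 1, 7175, 1125899671921656⟩,
   ⟨10, 1024, 33, 1, 948, 1125899879316555⟩, ⟨11, 2048, 34, 1, 874, 1125899884690581⟩,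
   ⟨12, 4096, 36, 1, 729, 1125899893669158⟩, ⟨13, 8192, 40, 1, 455, 1125899903139384⟩,
   ⟨14, 16384, 48, 1, 63, 1125899906351040⟩, ⟨15, 32768, 7, 1, 25088, 1125899906817535⟩,
   ⟨16, 65536, 11, 1, 20736, 1125899906821887⟩, ⟨17, 131072, 13, 1, 18560, 1125899906824063⟩,
   ⟨18, 262144, 14, 1, 17472, 1125899906825151⟩, ⟨19, 524288, 19, 1, 12320, 1125899906830303⟩,
   ⟨20, 1048576, 21, 1, 10256, 1125899906832367⟩, ⟨21, 2097152, 22, 1, 9224, 1125899906833399⟩,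
   ⟨22, 4194304, 25, 1, 6148, 1125899906836475⟩, ⟨23, 8388608, 26, 1, 5122, 1125899906837501⟩,
   ⟨24, 16777216, 28, 1, 3073, 1125899906839550⟩, ⟨25, 33554432, 35, 1, 800, 1125899906841823⟩,
   ⟨26, 67108864, 37, 1, 656, 1125899906841967⟩, ⟨27, 134217728, 38, 1, 584, 1125899906842039⟩,
   ⟨28, 268435456, 41, 1, 388, 1125899906842235⟩,
   ⟨29, 536870912, 42, 1, 322, 1125899906842301⟩,
   ⟨30, 1073741824, 44, 1, 193, 1125899906842430⟩,
   ⟨31, 2147483648, 49, 1, 52, 1125899906842571⟩,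
   ⟨32, 4294967296, 50, 1, 42, 1125899906842581⟩,
   ⟨33, 8589934592, 52, 1, 25, 1125899906842598⟩,
   ⟨34, 17179869184, 56, 1, 7, 1125899906842616⟩,
   ⟨35, 34359738368, 15, 1, 16384, 1125899906842623⟩,
   ⟨36, 68719476736, 23, 1, 8192, 1125899906842623⟩,
   ⟨37, 137438953472, 27, 1, 4096, 1125899906842623⟩,
   ⟨38, 274877906944, 29, 1, 2048, 1125899906842623⟩,
   ⟨39, 549755813888, 30, 1, 1024, 1125899906842623⟩,
   ⟨40, 1099511627776, 39, 1, 512, 1125899906842623⟩,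
   ⟨41, 2199023255552, 43, 1, 256, 1125899906842623⟩,
   ⟨42, 4398046511104, 45, 1, 128, 1125899906842623⟩,
   ⟨43, 8796093022208, 46, 1, 64, 1125899906842623⟩,
   ⟨44, 17592186044416, 51, 1, 32, 1125899906842623⟩,
   ⟨45, 35184372088832, 53, 1, 16, 1125899906842623⟩,
   ⟨46, 70368744177664, 54, 1, 8, 1125899906842623⟩,
   ⟨47, 140737488355328, 57, 1, 4, 1125899906842623⟩,
   ⟨48, 281474976710656, 58, 1, 2, 1125899906842623⟩,
   ⟨49, 562949953421312, 60, 1, 1, 1125899906842623⟩]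

theorem ok62 : tableOK 6 2 ys62 tab62 = true := by decide +kernel

theorem sr62 : search tab62 (2 ^ 15 - 1) 5 0 (2 ^ 50 - 1) = true := by
  decide +kernel

/-- The `3`-subsets of `6` elements. -/
def ys63 : List ℕ :=
  [7, 11, 13, 14, 19, 21, 22, 25, 26, 28, 35, 37, 38, 41, 42, 44, 49, 50, 52, 56]

/-- Killer table for `6` fractional candidates of total weight `3`. -/
def tab63 : List Entry :=
  [⟨0, 1, 7, 2, 1041280, 1180590626206995455103⟩,
   ⟨1, 2, 11, 2, 1022560, 1180590943280271746463⟩,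
   ⟨2, 4, 13, 2, 1004880, 1180591242416422431407⟩,
   ⟨3, 8, 14, 2, 994480, 1180591418372776842063⟩,
   ⟨4, 16, 19, 2, 850444, 1180591050483158943219⟩,
   ⟨5, 32, 21, 2, 718090, 1180591333126383667957⟩,
   ⟨6, 64, 22, 2, 650374, 1180591476097263473529⟩,
   ⟨7, 128, 25, 2, 449609, 1180591545469579633590⟩,
   ⟨8, 256, 26, 2, 375845, 1180591582887336887258⟩,
   ⟨9, 512, 28, 2, 228371, 1180591601647755232236⟩,
   ⟨10, 1024, 35, 2, 820204, 1180591057738969349139⟩,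
   ⟨11, 2048, 37, 2, 672730, 1180591339218526387237⟩,
   ⟨12, 4096, 38, 2, 598966, 1180591479964747357257⟩,
   ⟨13, 8192, 41, 2, 398201, 1180591550329603615878⟩,
   ⟨14, 16384, 42, 2, 330485, 1180591585522702021898⟩,
   ⟨15, 32768, 44, 2, 198131, 1180591603119452649996⟩,
   ⟨16, 65536, 49, 2, 54095, 1180591616302063234224⟩,
   ⟨17, 131072, 50, 2, 43695, 1180591618509686920528⟩,
   ⟨18, 262144, 52, 2, 26015, 1180591619613511359072⟩,
   ⟨19, 524288, 56, 2, 7295, 1180591620441385198464⟩,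
   ⟨20, 1048576, 3, 1, 819712, 1180591620717410483711⟩,
   ⟨21, 2097152, 5, 1, 672000, 1180591620717410631423⟩,
   ⟨22, 4194304, 6, 1, 598144, 1180591620717410705279⟩,
   ⟨23, 8388608, 9, 1, 397376, 1180591620717410906047⟩,
   ⟨24, 16777216, 10, 1, 329760, 1180591620717410973663⟩,
   ⟨25, 33554432, 12, 1, 197648, 1180591620717411105775⟩,
   ⟨26, 67108864, 15, 2, 983040, 1180591620717410320383⟩,
   ⟨27, 134217728, 17, 1, 53256, 1180591620717411250167⟩,
   ⟨28, 268435456, 18, 1, 43012, 1180591620717411260411⟩,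
   ⟨29, 536870912, 20, 1, 25602, 1180591620717411277821⟩,
   ⟨30, 1073741824, 23, 2, 581632, 1180591620717410721791⟩,
   ⟨31, 2147483648, 24, 1, 7169, 1180591620717411296254⟩,
   ⟨32, 4294967296, 27, 2, 301056, 1180591620717411002367⟩,
   ⟨33, 8589934592, 29, 2, 152576, 1180591620717411150847⟩,
   ⟨34, 17179869184, 30, 2, 76800, 1180591620717411226623⟩,
   ⟨35, 34359738368, 33, 1, 840, 1180591620717411302583⟩,
   ⟨36, 68719476736, 34, 1, 676, 1180591620717411302747⟩,
   ⟨37, 137438953472, 36, 1, 402, 1180591620717411303021⟩,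
   ⟨38, 274877906944, 39, 2, 525184, 1180591620717410778239⟩,
   ⟨39, 549755813888, 40, 1, 113, 1180591620717411303310⟩,
   ⟨40, 1099511627776, 43, 2, 262752, 1180591620717411040671⟩,
   ⟨41, 2199023255552, 45, 2, 131408, 1180591620717411172015⟩,
   ⟨42, 4398046511104, 46, 2, 65712, 1180591620717411237711⟩,
   ⟨43, 8796093022208, 48, 1, 15, 1180591620717411303408⟩,
   ⟨44, 17592186044416, 51, 2, 33292, 1180591620717411270131⟩,
   ⟨45, 35184372088832, 53, 2, 16650, 1180591620717411286773⟩,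
   ⟨46, 70368744177664, 54, 2, 8326, 1180591620717411295097⟩,
   ⟨47, 140737488355328, 57, 2, 4169, 1180591620717411299254⟩,
   ⟨48, 281474976710656, 58, 2, 2085, 1180591620717411301338⟩,
   ⟨49, 562949953421312, 60, 2, 1043, 1180591620717411302380⟩,
   ⟨50, 1125899906842624, 7, 1, 524288, 1180591620717411303423⟩,
   ⟨51, 2251799813685248, 11, 1, 262144, 1180591620717411303423⟩,
   ⟨52, 4503599627370496, 13, 1, 131072, 1180591620717411303423⟩,
   ⟨53, 9007199254740992, 14, 1, 65536, 1180591620717411303423⟩,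
   ⟨54, 18014398509481984, 19, 1, 32768, 1180591620717411303423⟩,
   ⟨55, 36028797018963968, 21, 1, 16384, 1180591620717411303423⟩,
   ⟨56, 72057594037927936, 22, 1, 8192, 1180591620717411303423⟩,
   ⟨57, 144115188075855872, 25, 1, 4096, 1180591620717411303423⟩,
   ⟨58, 288230376151711744, 26, 1, 2048, 1180591620717411303423⟩,
   ⟨59, 576460752303423488, 28, 1, 1024, 1180591620717411303423⟩,
   ⟨60, 1152921504606846976, 35, 1, 512, 1180591620717411303423⟩,
   ⟨61, 2305843009213693952, 37, 1, 256, 1180591620717411303423⟩,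
   ⟨62, 4611686018427387904, 38, 1, 128, 1180591620717411303423⟩,
   ⟨63, 9223372036854775808, 41, 1, 64, 1180591620717411303423⟩,
   ⟨64, 18446744073709551616, 42, 1, 32, 1180591620717411303423⟩,
   ⟨65, 36893488147419103232, 44, 1, 16, 1180591620717411303423⟩,
   ⟨66, 73786976294838206464, 49, 1, 8, 1180591620717411303423⟩,
   ⟨67, 147573952589676412928, 50, 1, 4, 1180591620717411303423⟩,
   ⟨68, 295147905179352825856, 52, 1, 2, 1180591620717411303423⟩,
   ⟨69, 590295810358705651712, 56, 1, 1, 1180591620717411303423⟩]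

theorem ok63 : tableOK 6 3 ys63 tab63 = true := by decide +kernel

theorem sr63 : search tab63 (2 ^ 20 - 1) 5 0 (2 ^ 70 - 1) = true := by
  decide +kernel

/-- The `4`-subsets of `6` elements. -/
def ys64 : List ℕ :=
  [15, 23, 27, 29, 30, 39, 43, 45, 46, 51, 53, 54, 57, 58, 60]

/-- Killer table for `6` fractional candidates of total weight `4`. -/
def tab64 : List Entry :=
  [⟨0, 1, 15, 3, 32256, 1125867694555647⟩, ⟨1, 2, 23, 3, 29120, 1125880847896127⟩,
   ⟨2, 4, 27, 3, 19872, 1125890041819743⟩, ⟨3, 8, 29, 3, 11104, 1125894907221151⟩,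
   ⟨4, 16, 30, 3, 5856, 1125897390254367⟩, ⟨5, 32, 39, 3, 28700, 1125882697584611⟩,
   ⟨6, 64, 43, 3, 19482, 1125891296965605⟩, ⟨7, 128, 45, 3, 10774, 1125895600854505⟩,
   ⟨8, 256, 46, 3, 5646, 1125897753586161⟩, ⟨9, 512, 51, 3, 16793, 1125898815913574⟩,
   ⟨10, 1024, 53, 3, 8533, 1125899361246890⟩, ⟨11, 2048, 54, 3, 4301, 1125899634011954⟩,
   ⟨12, 4096, 57, 3, 2355, 1125899770230476⟩, ⟨13, 8192, 58, 3, 1195, 1125899838520148⟩,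
   ⟨14, 16384, 60, 3, 615, 1125899872664984⟩, ⟨15, 32768, 7, 2, 28672, 1125899906813951⟩,
   ⟨16, 65536, 11, 2, 19456, 1125899906823167⟩, ⟨17, 131072, 13, 2, 10752, 1125899906831871⟩,
   ⟨18, 262144, 14, 2, 5632, 1125899906836991⟩, ⟨19, 524288, 19, 2, 16768, 1125899906825855⟩,
   ⟨20, 1048576, 21, 2, 8512, 1125899906834111⟩, ⟨21, 2097152, 22, 2, 4288, 1125899906838335⟩,
   ⟨22, 4194304, 25, 2, 2336, 1125899906840287⟩, ⟨23, 8388608, 26, 2, 1184, 1125899906841439⟩,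
   ⟨24, 16777216, 28, 2, 608, 1125899906842015⟩,
   ⟨25, 33554432, 35, 2, 16408, 1125899906826215⟩,
   ⟨26, 67108864, 37, 2, 8212, 1125899906834411⟩,
   ⟨27, 134217728, 38, 2, 4108, 1125899906838515⟩,
   ⟨28, 268435456, 41, 2, 2066, 1125899906840557⟩,
   ⟨29, 536870912, 42, 2, 1034, 1125899906841589⟩,
   ⟨30, 1073741824, 44, 2, 518, 1125899906842105⟩,
   ⟨31, 2147483648, 49, 2, 273, 1125899906842350⟩,
   ⟨32, 4294967296, 50, 2, 137, 1125899906842486⟩,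
   ⟨33, 8589934592, 52, 2, 69, 1125899906842554⟩,
   ⟨34, 17179869184, 56, 2, 35, 1125899906842588⟩,
   ⟨35, 34359738368, 3, 1, 16384, 1125899906842623⟩,
   ⟨36, 68719476736, 5, 1, 8192, 1125899906842623⟩,
   ⟨37, 137438953472, 6, 1, 4096, 1125899906842623⟩,
   ⟨38, 274877906944, 9, 1, 2048, 1125899906842623⟩,
   ⟨39, 549755813888, 10, 1, 1024, 1125899906842623⟩,
   ⟨40, 1099511627776, 12, 1, 512, 1125899906842623⟩,
   ⟨41, 2199023255552, 17, 1, 256, 1125899906842623⟩,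
   ⟨42, 4398046511104, 18, 1, 128, 1125899906842623⟩,
   ⟨43, 8796093022208, 20, 1, 64, 1125899906842623⟩,
   ⟨44, 17592186044416, 24, 1, 32, 1125899906842623⟩,
   ⟨45, 35184372088832, 33, 1, 16, 1125899906842623⟩,
   ⟨46, 70368744177664, 34, 1, 8, 1125899906842623⟩,
   ⟨47, 140737488355328, 36, 1, 4, 1125899906842623⟩,
   ⟨48, 281474976710656, 40, 1, 2, 1125899906842623⟩,
   ⟨49, 562949953421312, 48, 1, 1, 1125899906842623⟩]

theorem ok64 : tableOK 6 4 ys64 tab64 = true := by decide +kernel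

theorem sr64 : search tab64 (2 ^ 15 - 1) 5 0 (2 ^ 50 - 1) = true := by
  decide +kernel

/-- The `5`-subsets of `6` elements. -/
def ys65 : List ℕ :=
  [31, 47, 55, 59, 61, 62]

theorem ok65 : tableOK 6 5 ys65 [] = true := by decide +kernel

theorem sr65 : search [] (2 ^ 6 - 1) 5 0 (2 ^ 0 - 1) = true := by
  decide +kernel

/-- The rounding lemma. -/
theorem rounding {m k : ℕ} {f : ℕ → ℝ} (hm : m ≤ 6)
    (hf : ∀ e < m, 0 < f e ∧ f e < 1) (hk : ∑ e ∈ Finset.range m, f e = k)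
    (D : Fin 5 → ℕ) (hD : ∀ i, D i < 2 ^ m) :
    ∃ y : ℕ, popc m y = k ∧ ∀ i (t : ℤ), (t : ℝ) ≤ fs m f (D i) → t ≤ popc m (D i &&& y) := by
  rcases Nat.eq_zero_or_pos m with rfl | hm0
  · refine ⟨0, ?_, fun i t ht => ?_⟩
    · have : (k : ℝ) = 0 := by rw [← hk]; simp
      have : k = 0 := by exact_mod_cast this
      rw [this]; rfl
    · have : (t : ℝ) ≤ 0 := by simpa [fs] using ht
      have : t ≤ 0 := by exact_mod_cast this
      exact this.trans (by positivity)
  have hne : (Finset.range m).Nonempty := ⟨0, Finset.mem_range.2 hm0⟩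
  have hk0 : 0 < k := by
    have : (0 : ℝ) < k := by
      rw [← hk]
      exact Finset.sum_pos (fun e he => (hf e (Finset.mem_range.1 he)).1) hne
    exact_mod_cast this
  have hkm : k < m := by
    have : (k : ℝ) < m := by
      rw [← hk]
      calc ∑ e ∈ Finset.range m, f e < ∑ e ∈ Finset.range m, (1 : ℝ) :=
            Finset.sum_lt_sum_of_nonempty hne fun e he => (hf e (Finset.mem_range.1 he)).2
        _ = m := by simp
    exact_mod_cast this
  interval_cases m
  · omega
  · interval_cases k
    · exact rounding_of_cert ys21 [] ok21 sr21 hf hk D hD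
  · interval_cases k
    · exact rounding_of_cert ys31 [] ok31 sr31 hf hk D hD
    · exact rounding_of_cert ys32 [] ok32 sr32 hf hk D hD
  · interval_cases k
    · exact rounding_of_cert ys41 [] ok41 sr41 hf hk D hD
    · exact rounding_of_cert ys42 tab42 ok42 sr42 hf hk D hD
    · exact rounding_of_cert ys43 [] ok43 sr43 hf hk D hD
  · interval_cases k
    · exact rounding_of_cert ys51 [] ok51 sr51 hf hk D hD
    · exact rounding_of_cert ys52 tab52 ok52 sr52 hf hk D hD
    · exact rounding_of_cert ys53 tab53 ok53 sr53 hf hk D hD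
    · exact rounding_of_cert ys54 [] ok54 sr54 hf hk D hD
  · interval_cases k
    · exact rounding_of_cert ys61 [] ok61 sr61 hf hk D hD
    · exact rounding_of_cert ys62 tab62 ok62 sr62 hf hk D hD
    · exact rounding_of_cert ys63 tab63 ok63 sr63 hf hk D hD
    · exact rounding_of_cert ys64 tab64 ok64 sr64 hf hk D hD
    · exact rounding_of_cert ys65 [] ok65 sr65 hf hk D hD

/-! ## Reduction to few fractional candidates -/

/-- The candidate types with fractional weight. -/
noncomputable def fracSet (x : Typ 5 → ℝ) : Finset (Typ 5) :=
  Finset.univ.filter fun R => Int.fract (x R) ≠ 0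

theorem mem_fracSet {x : Typ 5 → ℝ} {R : Typ 5} : R ∈ fracSet x ↔ Int.fract (x R) ≠ 0 := by
  simp [fracSet]

/-- Fractional feasibility of `u`, witnessed by `x`. -/
def Feas (c : Typ 5 → ℕ) (k : ℕ) (u : Fin 5 → ℤ) (x : Typ 5 → ℝ) : Prop :=
  IsFracCommittee c k x ∧ ∀ i, (u i : ℝ) ≤ fracUtil x i

theorem floor_add_one_le {a : ℝ} {n : ℕ} (h : Int.fract a ≠ 0) (hn : a ≤ n) :
    (⌊a⌋ : ℝ) + 1 ≤ n := by
  have h1 : a ≠ n := by rintro rfl; simp at h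
  have h2 : a < ((n : ℤ) : ℝ) := by exact_mod_cast lt_of_le_of_ne hn h1
  have h3 : ⌊a⌋ < (n : ℤ) := Int.floor_lt.2 h2
  have h4 : ⌊a⌋ + 1 ≤ (n : ℤ) := h3
  exact_mod_cast h4

theorem fract_pos' {a : ℝ} (h : Int.fract a ≠ 0) : 0 < Int.fract a :=
  lt_of_le_of_ne (Int.fract_nonneg a) (Ne.symm h)

/-- Step A: a minimal solution may be assumed to use the whole committee size. -/
theorem stepA {c : Typ 5 → ℕ} {k : ℕ} {u : Fin 5 → ℤ} {x : Typ 5 → ℝ} (hx : Feas c k u x)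
    (hmin : ∀ x', Feas c k u x' → (fracSet x).card ≤ (fracSet x').card)
    (hne : (fracSet x).Nonempty) :
    ∃ x', Feas c k u x' ∧ (fracSet x').card ≤ (fracSet x).card ∧ ∑ R, x' R = k := by
  classical
  by_cases hs : ∑ R, x R = k
  · exact ⟨x, hx, le_rfl, hs⟩
  obtain ⟨R0, hR0⟩ := hne
  have hR0' := mem_fracSet.1 hR0
  obtain ⟨⟨h1, h2, h3⟩, h4⟩ := hx
  have hlt : ∑ R, x R < k := lt_of_le_of_ne h3 hs
  have hfl : (⌊x R0⌋ : ℝ) + Int.fract (x R0) = x R0 := Int.floor_add_fract _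
  have hf1 := Int.fract_lt_one (x R0)
  have hup := floor_add_one_le hR0' (h2 R0)
  -- feasibility of raising one coordinate
  have raise : ∀ δ : ℝ, 0 ≤ δ → δ ≤ 1 - Int.fract (x R0) → ∑ R, x R + δ ≤ k →
      Feas c k u (fun R => x R + if R = R0 then δ else 0) := by
    intro δ hδ hδ1 hδ2
    refine ⟨⟨fun R => ?_, fun R => ?_, ?_⟩, fun i => (h4 i).trans ?_⟩
    · have := h1 R
      dsimp only
      split_ifs <;> linarith
    · have := h2 R
      dsimp only
      split_ifs with h
      · subst h; linarith
      · linarith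
    · rw [Finset.sum_add_distrib]
      simpa using hδ2
    · unfold fracUtil
      refine Finset.sum_le_sum fun R _ => ?_
      dsimp only
      split_ifs <;> linarith
  by_cases hbig : ∑ R, x R + (1 - Int.fract (x R0)) ≤ k
  · exfalso
    have hF := hmin _ (raise (1 - Int.fract (x R0)) (by linarith) le_rfl hbig)
    have hsub : fracSet (fun R => x R + if R = R0 then 1 - Int.fract (x R0) else 0) ⊆
        (fracSet x).erase R0 := by
      intro R hR
      rw [mem_fracSet] at hR
      rw [Finset.mem_erase, mem_fracSet]
      by_cases h : R = R0
      · exfalso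
        subst h
        apply hR
        have : x R + (1 - Int.fract (x R)) = ((⌊x R⌋ + 1 : ℤ) : ℝ) := by push_cast; linarith
        simp only [if_true]
        rw [this, Int.fract_intCast]
      · simp only [h, if_false, add_zero] at hR
        exact ⟨h, hR⟩
    have := Finset.card_le_card hsub
    rw [Finset.card_erase_of_mem hR0] at this
    have hpos := Finset.card_pos.2 ⟨R0, hR0⟩
    omega
  · push Not at hbig
    refine ⟨_, raise (k - ∑ R, x R) (by linarith) (by linarith) (by linarith), ?_, ?_⟩
    · refine Finset.card_le_card fun R hR => ?_
      by_cases h : R = R0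
      · subst h; exact hR0
      · rw [mem_fracSet] at hR ⊢
        simpa only [h, if_false, add_zero] using hR
    · rw [Finset.sum_add_distrib]
      simp

/-- Step B: a minimal solution has at most six fractional candidate types. -/
theorem stepB {c : Typ 5 → ℕ} {k : ℕ} {u : Fin 5 → ℤ} {x : Typ 5 → ℝ} (hx : Feas c k u x)
    (hmin : ∀ x', Feas c k u x' → (fracSet x).card ≤ (fracSet x').card) :
    (fracSet x).card ≤ 6 := by
  classical
  by_contra hcard
  push Not at hcard
  obtain ⟨⟨h1, h2, h3⟩, h4⟩ := hx
  let M : Matrix (Option (Fin 5)) (fracSet x) ℝ := fun o R =>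
    match o with
    | none => 1
    | some i => if i ∈ R.1.1 then 1 else 0
  have hker : LinearMap.ker M.mulVecLin ≠ ⊥ := by
    apply LinearMap.ker_ne_bot_of_finrank_lt
    simpa using hcard
  obtain ⟨v, hv, hv0⟩ := Submodule.exists_mem_ne_zero_of_ne_bot hker
  rw [LinearMap.mem_ker, Matrix.mulVecLin_apply] at hv
  let w : Typ 5 → ℝ := fun R => if h : R ∈ fracSet x then v ⟨R, h⟩ else 0
  have hwv : ∀ R : fracSet x, w R.1 = v R := fun R => by simp [w]
  have hw0 : ∀ R, R ∉ fracSet x → w R = 0 := fun R hR => by simp [w, hR]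
  have hsum : ∀ g : Typ 5 → ℝ, ∑ R, g R * w R = ∑ R : fracSet x, g R.1 * v R := by
    intro g
    rw [← Finset.sum_subset (Finset.subset_univ (fracSet x))
      (fun R _ hR => by rw [hw0 R hR, mul_zero]), ← Finset.sum_coe_sort]
    exact Finset.sum_congr rfl fun R _ => by rw [hwv R]
  have hs0 : ∑ R, w R = 0 := by
    have := congrFun hv none
    have e := hsum fun _ => 1
    simp only [one_mul] at e
    rw [e]
    simpa [Matrix.mulVec, dotProduct, M] using this
  have hsi : ∀ i : Fin 5, ∑ R : Typ 5, (if i ∈ R.1 then w R else 0) = 0 := by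
    intro i
    have := congrFun hv (some i)
    have e := hsum fun R => if i ∈ R.1 then 1 else 0
    simp only [ite_mul, one_mul, zero_mul] at e
    rw [e]
    simpa [Matrix.mulVec, dotProduct, M] using this
  let P : Finset (Typ 5) := (fracSet x).filter fun R => w R ≠ 0
  have hP : P.Nonempty := by
    obtain ⟨R, hR⟩ := Function.ne_iff.1 hv0
    refine ⟨R.1, Finset.mem_filter.2 ⟨R.2, ?_⟩⟩
    rw [hwv]; exact hR
  let τ : Typ 5 → ℝ := fun R =>
    if 0 < w R then (1 - Int.fract (x R)) / w R else Int.fract (x R) / (-w R)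
  obtain ⟨R1, hR1, hle⟩ := Finset.exists_min_image P τ hP
  obtain ⟨hR1F, hR1w⟩ := Finset.mem_filter.1 hR1
  have hτpos : 0 ≤ τ R1 := by
    have a := Int.fract_lt_one (x R1)
    have b := Int.fract_nonneg (x R1)
    dsimp only [τ]
    split_ifs with h
    · exact div_nonneg (by linarith) h.le
    · exact div_nonneg b (by linarith)
  have hbox : ∀ R ∈ fracSet x,
      0 ≤ Int.fract (x R) + τ R1 * w R ∧ Int.fract (x R) + τ R1 * w R ≤ 1 := by
    intro R hR
    have a := Int.fract_lt_one (x R)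
    have b := Int.fract_nonneg (x R)
    by_cases hw : w R = 0
    · rw [hw]; constructor <;> linarith
    have hRP : R ∈ P := Finset.mem_filter.2 ⟨hR, hw⟩
    have hl := hle R hRP
    rcases lt_or_gt_of_ne hw with hneg | hpos
    · have e : τ R = Int.fract (x R) / (-w R) := by simp [τ, not_lt.2 hneg.le]
      rw [e, le_div_iff₀ (by linarith)] at hl
      have : τ R1 * w R ≤ 0 := mul_nonpos_of_nonneg_of_nonpos hτpos hneg.le
      constructor <;> linarith
    · have e : τ R = (1 - Int.fract (x R)) / w R := by simp [τ, hpos]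
      rw [e, le_div_iff₀ hpos] at hl
      have : 0 ≤ τ R1 * w R := mul_nonneg hτpos hpos.le
      constructor <;> linarith
  have hfeas : Feas c k u (fun R => x R + τ R1 * w R) := by
    refine ⟨⟨fun R => ?_, fun R => ?_, ?_⟩, fun i => (h4 i).trans_eq ?_⟩
    · by_cases hR : R ∈ fracSet x
      · have hb := hbox R hR
        have e : (⌊x R⌋ : ℝ) + Int.fract (x R) = x R := Int.floor_add_fract _
        have : (0 : ℝ) ≤ ⌊x R⌋ := by exact_mod_cast Int.floor_nonneg.2 (h1 R)
        dsimp only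
        linarith
      · simpa [hw0 R hR] using h1 R
    · by_cases hR : R ∈ fracSet x
      · have hb := hbox R hR
        have e : (⌊x R⌋ : ℝ) + Int.fract (x R) = x R := Int.floor_add_fract _
        have := floor_add_one_le (mem_fracSet.1 hR) (h2 R)
        dsimp only
        linarith
      · simpa [hw0 R hR] using h2 R
    · rw [Finset.sum_add_distrib, ← Finset.mul_sum, hs0, mul_zero, add_zero]
      exact h3
    · unfold fracUtil
      have e : ∀ R : Typ 5, (if i ∈ R.1 then x R + τ R1 * w R else 0) =
          (if i ∈ R.1 then x R else 0) + τ R1 * (if i ∈ R.1 then w R else 0) := by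
        intro R; split_ifs <;> simp
      rw [Finset.sum_congr rfl fun R _ => e R, Finset.sum_add_distrib, ← Finset.mul_sum, hsi,
        mul_zero, add_zero]
  have hF := hmin _ hfeas
  have hsub : fracSet (fun R => x R + τ R1 * w R) ⊆ (fracSet x).erase R1 := by
    intro R hR
    rw [mem_fracSet] at hR
    rw [Finset.mem_erase]
    constructor
    · rintro rfl
      apply hR
      have e : (⌊x R⌋ : ℝ) + Int.fract (x R) = x R := Int.floor_add_fract _
      dsimp only [τ]
      split_ifs with h
      · have : x R + (1 - Int.fract (x R)) / w R * w R = ((⌊x R⌋ + 1 : ℤ) : ℝ) := by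
          rw [div_mul_cancel₀ _ hR1w]; push_cast; linarith
        rw [this, Int.fract_intCast]
      · have : x R + Int.fract (x R) / (-w R) * w R = ((⌊x R⌋ : ℤ) : ℝ) := by
          rw [div_neg, neg_mul, div_mul_cancel₀ _ hR1w]; linarith
        rw [this, Int.fract_intCast]
    · by_contra h
      apply hR
      have h' : Int.fract (x R) = 0 := by
        by_contra h''; exact h (mem_fracSet.2 h'')
      simpa [hw0 R h] using h'
  have := Finset.card_le_card hsub
  rw [Finset.card_erase_of_mem hR1F] at this
  omega

theorem sum_transfer {M : Type*} [AddCommMonoid M] (F : Finset (Typ 5)) (G : ℕ → M)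
    (H : Typ 5 → M) (h0 : ∀ R, R ∉ F → H R = 0) (h : ∀ R : F, G (F.equivFin R) = H R.1) :
    ∑ n ∈ Finset.range F.card, G n = ∑ R, H R := by
  rw [Finset.sum_range, ← Equiv.sum_comp F.equivFin,
    ← Finset.sum_subset (Finset.subset_univ F) (fun R _ hR => h0 R hR), ← Finset.sum_coe_sort F H]
  exact Finset.sum_congr rfl fun R _ => h R

/-- Step C: rounding. -/
theorem stepC {c : Typ 5 → ℕ} {k : ℕ} {u : Fin 5 → ℤ} {x : Typ 5 → ℝ} (hx : Feas c k u x)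
    (hcard : (fracSet x).card ≤ 6) (hsum : ∑ R, x R = k) : IntFeasible c k u := by
  classical
  obtain ⟨⟨h1, h2, h3⟩, h4⟩ := hx
  set F := fracSet x with hF
  set m := F.card with hm
  let e := F.equivFin
  let f : ℕ → ℝ := fun n => if h : n < m then Int.fract (x (e.symm ⟨n, h⟩).1) else 0
  have hfe : ∀ R : F, f (e R) = Int.fract (x R.1) := by
    intro R
    have : ((e R : ℕ)) < m := (e R).2
    simp [f, this]
  have hff : ∀ n < m, 0 < f n ∧ f n < 1 := by
    intro n hn
    simp only [f, hn, dif_pos]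
    exact ⟨fract_pos' (mem_fracSet.1 (e.symm ⟨n, hn⟩).2), Int.fract_lt_one _⟩
  have hF0 : ∀ R, R ∉ F → Int.fract (x R) = 0 := by
    intro R hR
    by_contra h; exact hR (mem_fracSet.2 h)
  have hfsum : ∑ n ∈ Finset.range m, f n = ∑ R, Int.fract (x R) :=
    sum_transfer F f _ hF0 hfe
  have hfl0 : ∀ R, 0 ≤ ⌊x R⌋ := fun R => Int.floor_nonneg.2 (h1 R)
  have hk' : ∑ R, Int.fract (x R) = ((k - ∑ R, ⌊x R⌋ : ℤ) : ℝ) := by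
    push_cast
    rw [← hsum, ← Finset.sum_sub_distrib]
    exact Finset.sum_congr rfl fun R _ => rfl
  have hk0 : 0 ≤ (k - ∑ R, ⌊x R⌋ : ℤ) := by
    have : (0 : ℝ) ≤ ((k - ∑ R, ⌊x R⌋ : ℤ) : ℝ) := by
      rw [← hk']; exact Finset.sum_nonneg fun R _ => Int.fract_nonneg _
    exact_mod_cast this
  obtain ⟨k', hk'e⟩ := Int.eq_ofNat_of_zero_le hk0
  let D : Fin 5 → ℕ := fun i => Nat.ofBits fun j : Fin m => decide (i ∈ (e.symm j).1.1)
  have hD : ∀ i, D i < 2 ^ m := fun i => Nat.ofBits_lt_two_pow _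
  have hDb : ∀ i (R : F), (D i).testBit (e R) = decide (i ∈ R.1.1) := by
    intro i R
    have : ((e R : ℕ)) < m := (e R).2
    simp only [D]
    rw [Nat.testBit_ofBits_lt _ _ this]
    simp
  obtain ⟨y, hy, hyD⟩ := rounding (k := k') hcard hff
    (by rw [hfsum, hk', hk'e]; simp) D hD
  let b : Typ 5 → ℕ := fun R => if h : R ∈ F then (if y.testBit (e ⟨R, h⟩) then 1 else 0) else 0
  have hb0 : ∀ R, R ∉ F → b R = 0 := fun R hR => by simp [b, hR]
  have hbe : ∀ R : F, b R.1 = if y.testBit (e R) then 1 else 0 := fun R => by simp [b]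
  have hb1 : ∀ R, b R ≤ 1 := by
    intro R
    dsimp only [b]
    split_ifs <;> simp
  have hbsum : ∑ R, b R = k' := by
    rw [← hy, popc_eq]
    exact (sum_transfer F _ b hb0 fun R => (hbe R).symm).symm
  have hbD : ∀ i, popc m (D i &&& y) = ∑ R : Typ 5, if i ∈ R.1 then b R else 0 := by
    intro i
    rw [popc_eq]
    refine sum_transfer F _ _ (fun R hR => by simp [hb0 R hR]) fun R => ?_
    rw [Nat.testBit_and, hDb, hbe]
    by_cases h : i ∈ R.1.1 <;> simp [h, e]
  have hfD : ∀ i, fs m f (D i) = ∑ R : Typ 5, if i ∈ R.1 then Int.fract (x R) else 0 := by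
    intro i
    refine sum_transfer F _ _ (fun R hR => by simp [hF0 R hR]) fun R => ?_
    rw [hDb, hfe]
    by_cases h : i ∈ R.1.1 <;> simp [h, e]
  have hcast : ∀ R, ((⌊x R⌋.toNat : ℕ) : ℤ) = ⌊x R⌋ := fun R => Int.toNat_of_nonneg (hfl0 R)
  refine ⟨fun R => ⌊x R⌋.toNat + b R, ⟨fun R => ?_, ?_⟩, fun i => ?_⟩
  · by_cases hR : R ∈ F
    · have := floor_add_one_le (mem_fracSet.1 hR) (h2 R)
      have h5 : ⌊x R⌋ + 1 ≤ (c R : ℤ) := by exact_mod_cast this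
      have h6 := hb1 R
      have h7 := hcast R
      dsimp only
      omega
    · have h5 : (⌊x R⌋ : ℝ) ≤ c R := (Int.floor_le _).trans (h2 R)
      have h5 : ⌊x R⌋ ≤ (c R : ℤ) := by exact_mod_cast h5
      have h7 := hcast R
      have h8 := hb0 R hR
      dsimp only
      omega
  · have : ((∑ R, (⌊x R⌋.toNat + b R) : ℕ) : ℤ) = k := by
      rw [Finset.sum_add_distrib, hbsum]
      push_cast
      rw [Finset.sum_congr rfl fun R _ => hcast R]
      have : (k - ∑ R, ⌊x R⌋ : ℤ) = k' := hk'e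
      linarith
    exact_mod_cast this.le
  · have e1 : intUtil (fun R => ⌊x R⌋.toNat + b R) i =
        (∑ R : Typ 5, if i ∈ R.1 then ⌊x R⌋ else 0) + (popc m (D i &&& y) : ℤ) := by
      unfold intUtil
      rw [hbD]
      push_cast
      rw [← Finset.sum_add_distrib]
      refine Finset.sum_congr rfl fun R _ => ?_
      have := hcast R
      split_ifs
      · rw [hcast]
      · simp
    have e2 : fracUtil x i =
        ((∑ R : Typ 5, if i ∈ R.1 then ⌊x R⌋ else 0 : ℤ) : ℝ) + fs m f (D i) := by
      unfold fracUtil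
      rw [hfD]
      push_cast
      rw [← Finset.sum_add_distrib]
      refine Finset.sum_congr rfl fun R _ => ?_
      split_ifs
      · exact (Int.floor_add_fract _).symm
      · simp
    have e3 := h4 i
    rw [e2] at e3
    have e4 := hyD i (u i - ∑ R : Typ 5, if i ∈ R.1 then ⌊x R⌋ else 0) (by
      rw [Int.cast_sub]; linarith)
    rw [e1]
    linarith

theorem integralizable_five (c : Typ 5 → ℕ) (k : ℕ) : Integralizable c k := by
  classical
  intro u hu
  have hex : ∃ n, ∃ x, Feas c k u x ∧ (fracSet x).card = n := by
    obtain ⟨x, hx⟩ := hu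
    exact ⟨_, x, hx, rfl⟩
  obtain ⟨x, hx, hxn⟩ := Nat.find_spec hex
  have hmin : ∀ x', Feas c k u x' → (fracSet x).card ≤ (fracSet x').card := by
    intro x' hx'
    rw [hxn]
    exact Nat.find_min' hex ⟨x', hx', rfl⟩
  by_cases hne : (fracSet x).Nonempty
  · obtain ⟨x', hx', hc, hs⟩ := stepA hx hmin hne
    exact stepC hx' (hc.trans (stepB hx hmin)) hs
  · have h0 : ∀ R, Int.fract (x R) = 0 := by
      intro R
      by_contra h
      exact hne ⟨R, mem_fracSet.2 h⟩
    obtain ⟨⟨h1, h2, h3⟩, h4⟩ := hx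
    have hcR : ∀ R, ((⌊x R⌋.toNat : ℕ) : ℝ) = x R := by
      intro R
      have a : ((⌊x R⌋.toNat : ℕ) : ℤ) = ⌊x R⌋ := Int.toNat_of_nonneg (Int.floor_nonneg.2 (h1 R))
      have b : (((⌊x R⌋.toNat : ℕ) : ℤ) : ℝ) = (⌊x R⌋ : ℝ) := by rw [a]
      have c : (⌊x R⌋ : ℝ) + Int.fract (x R) = x R := Int.floor_add_fract _
      rw [h0, add_zero] at c
      rw [Int.cast_natCast] at b
      exact b.trans c
    refine ⟨fun R => ⌊x R⌋.toNat, ⟨fun R => ?_, ?_⟩, fun i => ?_⟩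
    · have := h2 R
      rw [← hcR R] at this
      exact_mod_cast this
    · have : ((∑ R, ⌊x R⌋.toNat : ℕ) : ℝ) ≤ k := by
        push_cast
        rw [Finset.sum_congr rfl fun R _ => hcR R]
        exact h3
      exact_mod_cast this
    · have e : ((intUtil (fun R => ⌊x R⌋.toNat) i : ℤ) : ℝ) = fracUtil x i := by
        unfold intUtil fracUtil
        push_cast
        refine Finset.sum_congr rfl fun R _ => ?_
        rw [hcR R]
      have := h4 i
      rw [← e] at this
      exact_mod_cast this

theorem cone_five (c : Typ 5 → ℤ) (k : ℤ) (u : Fin 5 → ℤ) (h : InCone c k u) :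
    InMonoid c k u := by
  obtain ⟨x, z, t, s, hx, hz, ht, hs, hc, hk, hu⟩ := h
  have hc0 : ∀ R, 0 ≤ c R := by
    intro R
    have : (0 : ℝ) ≤ c R := by rw [hc R]; exact add_nonneg (hx R) (hz R)
    exact_mod_cast this
  have hk0 : 0 ≤ k := by
    have : (0 : ℝ) ≤ k := by
      rw [hk]; exact add_nonneg (Finset.sum_nonneg fun R _ => hx R) ht
    exact_mod_cast this
  obtain ⟨k', rfl⟩ := Int.eq_ofNat_of_zero_le hk0
  have hcn : ∀ R, (((c R).toNat : ℕ) : ℤ) = c R := fun R => Int.toNat_of_nonneg (hc0 R)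
  have hcr : ∀ R, (((c R).toNat : ℕ) : ℝ) = (c R : ℝ) := by
    intro R
    have : ((((c R).toNat : ℕ) : ℤ) : ℝ) = (c R : ℝ) := by rw [hcn]
    rw [Int.cast_natCast] at this
    exact this
  obtain ⟨y, ⟨hy1, hy2⟩, hy3⟩ := integralizable_five (fun R => (c R).toNat) k' u
    ⟨x, ⟨hx, fun R => by
        have := hz R
        rw [hcr, hc R]; linarith, by
        have : (k' : ℝ) = ∑ R, x R + t := by simpa using hk
        linarith⟩, fun i => by
      have := hs i
      rw [hu i]; unfold fracUtil; linarith⟩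
  refine ⟨y, fun R => (c R).toNat - y R, k' - ∑ R, y R, fun i => (intUtil y i - u i).toNat,
    fun R => ?_, ?_, fun i => ?_⟩
  · have a := hy1 R
    have b := hcn R
    dsimp only at a ⊢
    omega
  · rw [Nat.cast_sub hy2]
    push_cast
    ring
  · rw [Int.toNat_of_nonneg (by linarith [hy3 i])]
    change u i = intUtil y i - _
    ring

/-- For `n = 5` voters, every instance is integralizable; equivalently, the
committee election monoid on five voters is integrally closed: every integer
point of its real cone lies in the monoid. -/
theorem stmt13 :
    (∀ (c : Typ 5 → ℕ) (k : ℕ), Integralizable c k) ∧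
    (∀ (c : Typ 5 → ℤ) (k : ℤ) (u : Fin 5 → ℤ), InCone c k u → InMonoid c k u) := by
  exact ⟨integralizable_five, cone_five⟩
end

section
/- Let n ≤ 5 and let x be a fractional committee for an instance (c,k,b). Then there exists an integral committee x' with u_i(x') ≥ ⌊u_i(x)⌋ for all voters i and ⌊x_R⌋ ≤ x'_R ≤ ⌈x_R⌉ for all candidate types R. -/
/-- Table-based population count of a six-bit mask. -/
def cmPc (v : ℕ) : ℕ := (5266721624626081916652898579601397356032429460333936579656 >>> (3 * v)) &&& 7

def cmKills (r : ℕ × ℕ) (T : ℕ) : Bool := Nat.ble (cmPc (T &&& r.1) + 1) r.2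

def cmCompat (m K : ℕ) (eq : Bool) (r s : ℕ × ℕ) : Bool :=
  let I := cmPc (r.1 &&& s.1)
  let O := m - cmPc (r.1 ||| s.1)
  let A := cmPc r.1 - I
  let B := cmPc s.1 - I
  let d := r.2 + s.2
  match eq with
  | false => Nat.ble (d + 1) (K + I) || (Nat.beq (I + O) 0 && Nat.ble d K)
  | true => 
    ((Nat.ble (d + 1) (K + I) && Nat.ble (K + 1) (d + O)) || (Nat.beq (I + O) 0 && Nat.beq d K)) &&
    ((Nat.ble (r.2 + 1) (s.2 + A) && Nat.ble (s.2 + 1) (r.2 + B)) || (Nat.beq (A + B) 0 && Nat.beq r.2 s.2))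

def cmSearch (m K : ℕ) (eq : Bool) : ℕ → List (ℕ × ℕ) → List ℕ → Bool
  | 0, _, [] => false
  | 0, _, _ :: _ => true
  | _ + 1, _, [] => false
  | d + 1, Rs, T :: U => Rs.all fun r => !cmKills r T ||
      cmSearch m K eq d (Rs.filter fun s =>
        !(Nat.ble (s.1 + 1) r.1 && cmKills s T) && cmCompat m K eq r s) (U.filter fun S => !cmKills r S)

def cmTrips (m K : ℕ) : List ℕ := (List.range (2 ^ m)).filter fun T => Nat.beq (cmPc T) K

def cmValid (m K : ℕ) (eq : Bool) (r : ℕ × ℕ) : Bool :=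
  Nat.ble (r.2 + 1) K && Nat.ble (r.2 + 1) (cmPc r.1) && 
  (!eq || Nat.ble (K + cmPc r.1 + 1) (r.2 + m))

def cmRows (m K : ℕ) (eq : Bool) : List (ℕ × ℕ) :=
  ((List.range (2 ^ m)).product (List.range 6)).filter fun r => 
    cmValid m K eq r && (cmTrips m K).any (cmKills r)

def cmCheck (m K : ℕ) (eq : Bool) : Bool := cmSearch m K eq 5 (cmRows m K eq) (cmTrips m K)

theorem cmCheck5 : ∀ m ∈ List.range 6, ∀ K ∈ List.range (m+1), cmCheck m K false = true := by
  decide +kernel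
theorem cmCheck6 : ∀ K ∈ List.range 7, cmCheck 6 K true = true := by
  decide +kernel

theorem cmSearch_sound (m K : ℕ) (eq : Bool) : ∀ (d : ℕ) (Rs : List (ℕ × ℕ)) (U : List ℕ)
    (L : List (ℕ × ℕ)), cmSearch m K eq d Rs U = true → L.length ≤ d →
    (∀ r ∈ L, (∃ T ∈ U, cmKills r T = true) → r ∈ Rs) →
    (∀ r ∈ L, ∀ s ∈ L, cmCompat m K eq r s = true) →
    ∃ T ∈ U, ∀ r ∈ L, cmKills r T = false := by
  intro d
  induction d with
  | zero =>
    intro Rs U L h hL h1 h2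
    have : L = [] := List.length_eq_zero_iff.1 (by omega)
    subst this
    cases U with
    | nil => simp [cmSearch] at h
    | cons T U => exact ⟨T, by simp, by simp⟩
  | succ d ih =>
    intro Rs U L h hL h1 h2
    cases U with
    | nil => simp [cmSearch] at h
    | cons T U =>
      by_cases hk : ∀ r ∈ L, cmKills r T = false
      · exact ⟨T, by simp, hk⟩
      have hne : (L.toFinset.filter fun r => cmKills r T = true).Nonempty := by
        push Not at hk
        obtain ⟨r, hr, hrT⟩ := hk
        exact ⟨r, by simpa [hr] using hrT⟩
      obtain ⟨r, hr, hmin⟩ := Finset.exists_min_image _ (fun r : ℕ × ℕ => r.1) hne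
      simp only [Finset.mem_filter, List.mem_toFinset] at hr hmin
      obtain ⟨hrL, hrT⟩ := hr
      have hrR : r ∈ Rs := h1 r hrL ⟨T, by simp, hrT⟩
      simp only [cmSearch, List.all_eq_true] at h
      have h3 := h r hrR
      rw [hrT] at h3
      simp only [Bool.not_true, Bool.false_or] at h3
      obtain ⟨T', hT', hT'L⟩ := ih _ _ (L.erase r) h3
        (by rw [List.length_erase_of_mem hrL]; omega)
        (by
          rintro s hs ⟨T', hT', hk'⟩
          have hsL := List.mem_of_mem_erase hs
          rw [List.mem_filter] at hT' ⊢
          refine ⟨h1 s hsL ⟨T', by simp [hT'.1], hk'⟩, ?_⟩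
          rw [h2 r hrL s hsL, Bool.and_true]
          by_cases hsT : cmKills s T = true
          · have := hmin s ⟨hsL, hsT⟩
            have hb : Nat.ble (s.1 + 1) r.1 = false := by
              rw [Bool.eq_false_iff, Ne, Nat.ble_eq]; omega
            simp [hb]
          · simp [hsT])
        (fun a ha b hb => h2 a (List.mem_of_mem_erase ha) b (List.mem_of_mem_erase hb))
      rw [List.mem_filter] at hT'
      refine ⟨T', by simp [hT'.1], fun s hs => ?_⟩
      by_cases hsr : s = r
      · subst hsr; simpa using hT'.2
      · exact hT'L s ((List.mem_erase_of_ne hsr).2 hs)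

/-- The bit mask of a set. -/
def cmMask {m : ℕ} (F : Finset (Fin m)) : ℕ := Nat.ofBits fun i => decide (i ∈ F)

theorem cmMask_lt {m : ℕ} (F : Finset (Fin m)) : cmMask F < 2 ^ m := Nat.ofBits_lt_two_pow _

theorem cmMask_testBit {m : ℕ} (F : Finset (Fin m)) (i : Fin m) :
    (cmMask F).testBit i = decide (i ∈ F) := by
  rw [cmMask, Nat.testBit_ofBits_lt _ _ i.2]

theorem cmMask_unique {m : ℕ} (F : Finset (Fin m)) (v : ℕ) (hv : v < 2 ^ m)
    (h : ∀ i : Fin m, v.testBit i = decide (i ∈ F)) : v = cmMask F := by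
  apply Nat.eq_of_testBit_eq
  intro i
  by_cases hi : i < m
  · exact (h ⟨i, hi⟩).trans (cmMask_testBit F ⟨i, hi⟩).symm
  · have h2 : 2 ^ m ≤ 2 ^ i := Nat.pow_le_pow_right (by norm_num) (by omega)
    rw [Nat.testBit_lt_two_pow (hv.trans_le h2),
      Nat.testBit_lt_two_pow ((cmMask_lt F).trans_le h2)]

theorem cmMask_and {m : ℕ} (F G : Finset (Fin m)) : cmMask F &&& cmMask G = cmMask (F ∩ G) := by
  apply cmMask_unique
  · exact Nat.and_lt_two_pow _ (cmMask_lt G)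
  · intro i
    simp [Nat.testBit_and, cmMask_testBit]

theorem cmMask_or {m : ℕ} (F G : Finset (Fin m)) : cmMask F ||| cmMask G = cmMask (F ∪ G) := by
  apply cmMask_unique
  · exact Nat.or_lt_two_pow (cmMask_lt F) (cmMask_lt G)
  · intro i
    simp [Nat.testBit_or, cmMask_testBit]

theorem cmPc_aux : ∀ m ∈ List.range 7, ∀ v ∈ List.range (2 ^ m),
    cmPc v = (Finset.univ.filter fun i : Fin m => v.testBit i = true).card := by
  decide +kernel

theorem cmPc_mask {m : ℕ} (hm : m ≤ 6) (F : Finset (Fin m)) : cmPc (cmMask F) = F.card := by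
  rw [cmPc_aux m (by simp; omega) _ (by simpa using cmMask_lt F)]
  congr 1
  ext i
  simp [cmMask_testBit]

theorem cm_bd {m : ℕ} (w : Fin m → ℝ) (h0 : ∀ i, 0 < w i) (h1 : ∀ i, w i < 1)
    (S : Finset (Fin m)) : (S.card = 0 ∧ ∑ i ∈ S, w i = 0) ∨
      (0 < S.card ∧ 0 < ∑ i ∈ S, w i ∧ ∑ i ∈ S, w i < S.card) := by
  rcases S.eq_empty_or_nonempty with rfl | hS
  · left; simp
  · right
    refine ⟨hS.card_pos, Finset.sum_pos (fun i _ => h0 i) hS, ?_⟩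
    calc ∑ i ∈ S, w i < ∑ i ∈ S, (1 : ℝ) := Finset.sum_lt_sum_of_nonempty hS fun i _ => h1 i
      _ = S.card := by simp

theorem cm_parts {m : ℕ} {M : Type*} [AddCommMonoid M] (w : Fin m → M) (F G : Finset (Fin m)) :
    ∑ i ∈ F, w i = ∑ i ∈ F \ G, w i + ∑ i ∈ F ∩ G, w i := by
  rw [add_comm, Finset.sum_inter_add_sum_sdiff]

theorem cmCompat_of {m K : ℕ} (hm : m ≤ 6) (eq : Bool) (w : Fin m → ℝ) (h0 : ∀ i, 0 < w i)
    (h1 : ∀ i, w i < 1) (hsum : ∑ i, w i = K) (F G : Finset (Fin m)) (t u : ℕ)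
    (ht : (t : ℝ) ≤ ∑ i ∈ F, w i) (hu : (u : ℝ) ≤ ∑ i ∈ G, w i)
    (het : eq = true → (t : ℝ) = ∑ i ∈ F, w i) (heu : eq = true → (u : ℝ) = ∑ i ∈ G, w i) :
    cmCompat m K eq (cmMask F, t) (cmMask G, u) = true := by
  have cF : F.card = (F \ G).card + (F ∩ G).card := by
    simpa using cm_parts (fun _ => 1) F G
  have cG : G.card = (G \ F).card + (F ∩ G).card := by
    rw [Finset.inter_comm F G]; simpa using cm_parts (fun _ => 1) G F
  have cO : m - (F ∪ G).card = ((F ∪ G)ᶜ).card := by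
    rw [Finset.card_compl, Fintype.card_fin]
  have wF := cm_parts w F G
  have wG := cm_parts w G F
  rw [Finset.inter_comm G F] at wG
  have wU : ∑ i ∈ F ∪ G, w i = ∑ i ∈ G, w i + ∑ i ∈ F \ G, w i := by
    rw [← Finset.sdiff_union_self_eq_union, Finset.sum_union Finset.sdiff_disjoint, add_comm]
  have wO := Finset.sum_add_sum_compl (F ∪ G) w
  rw [hsum] at wO
  have bI := cm_bd w h0 h1 (F ∩ G)
  have bO := cm_bd w h0 h1 (F ∪ G)ᶜ
  have bA := cm_bd w h0 h1 (F \ G)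
  have bB := cm_bd w h0 h1 (G \ F)
  simp only [cmCompat, cmMask_and, cmMask_or, cmPc_mask hm, cO]
  have eA : F.card - (F ∩ G).card = (F \ G).card := by omega
  have eB : G.card - (F ∩ G).card = (G \ F).card := by omega
  rw [eA, eB]
  generalize (F ∩ G).card = I at *
  generalize (F \ G).card = A at *
  generalize (G \ F).card = B at *
  generalize ((F ∪ G)ᶜ).card = O at *
  generalize ∑ i ∈ F ∩ G, w i = wI at *
  generalize ∑ i ∈ F \ G, w i = wA at *
  generalize ∑ i ∈ G \ F, w i = wB at *
  generalize ∑ i ∈ (F ∪ G)ᶜ, w i = wo at *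
  cases eq with
  | false =>
    simp only [Bool.or_eq_true, Bool.and_eq_true, Nat.ble_eq, Nat.beq_eq]
    by_cases hz : I + O = 0
    · right
      refine ⟨hz, ?_⟩
      have : (t : ℝ) + u ≤ K := by
        rcases bI with bI | bI <;> rcases bO with bO | bO <;> first | omega | linarith
      exact_mod_cast this
    · left
      have : (t : ℝ) + u < K + I := by
        rcases bI with bI | bI <;> rcases bO with bO | bO <;> first | omega | skip
        all_goals (have := Nat.cast_nonneg (α := ℝ) I; linarith)
      have : t + u < K + I := by exact_mod_cast this
      omega
  | true =>
    have het := het rfl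
    have heu := heu rfl
    simp only [Bool.or_eq_true, Bool.and_eq_true, Nat.ble_eq, Nat.beq_eq]
    have nI := Nat.cast_nonneg (α := ℝ) I
    have nO := Nat.cast_nonneg (α := ℝ) O
    have nA := Nat.cast_nonneg (α := ℝ) A
    have nB := Nat.cast_nonneg (α := ℝ) B
    constructor
    · by_cases hz : I + O = 0
      · right
        refine ⟨hz, ?_⟩
        have : (t : ℝ) + u = K := by
          rcases bI with bI | bI <;> rcases bO with bO | bO <;> first | omega | linarith
        exact_mod_cast this
      · left
        have h2 : (t : ℝ) + u < K + I ∧ (K : ℝ) < t + u + O := by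
          rcases bI with bI | bI <;> rcases bO with bO | bO <;> first | omega | skip
          all_goals (constructor <;> linarith)
        have h3 : t + u < K + I ∧ K < t + u + O := by exact_mod_cast h2
        omega
    · by_cases hz : A + B = 0
      · right
        refine ⟨hz, ?_⟩
        have : (t : ℝ) = u := by
          rcases bA with bA | bA <;> rcases bB with bB | bB <;> first | omega | linarith
        exact_mod_cast this
      · left
        have h2 : (t : ℝ) < u + A ∧ (u : ℝ) < t + B := by
          rcases bA with bA | bA <;> rcases bB with bB | bB <;> first | omega | skip
          all_goals (constructor <;> linarith)
        have h3 : t < u + A ∧ u < t + B := by exact_mod_cast h2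
        omega

theorem cm_comb {m K : ℕ} (hm : m ≤ 6) (eq : Bool) (hc : cmCheck m K eq = true)
    (w : Fin m → ℝ) (h0 : ∀ i, 0 < w i) (h1 : ∀ i, w i < 1) (hsum : ∑ i, w i = K)
    (F : Fin 5 → Finset (Fin m)) (t : Fin 5 → ℕ) (ht : ∀ j, (t j : ℝ) ≤ ∑ i ∈ F j, w i)
    (het : eq = true → ∀ j, (t j : ℝ) = ∑ i ∈ F j, w i) :
    ∃ T : Finset (Fin m), T.card = K ∧ ∀ j, t j ≤ (T ∩ F j).card := by
  have hmask : ∀ v < 2 ^ m, ∃ T : Finset (Fin m), v = cmMask T := fun v hv =>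
    ⟨Finset.univ.filter fun i => v.testBit i = true, cmMask_unique _ _ hv (by simp)⟩
  have htr : ∀ v ∈ cmTrips m K, ∃ T : Finset (Fin m), v = cmMask T ∧ T.card = K := by
    intro v hv
    simp only [cmTrips, List.mem_filter, List.mem_range, Nat.beq_eq] at hv
    obtain ⟨T, rfl⟩ := hmask v hv.1
    exact ⟨T, rfl, by rw [← cmPc_mask hm T]; exact hv.2⟩
  obtain ⟨v, hv, hvL⟩ := cmSearch_sound m K eq 5 _ _ (List.ofFn fun j => (cmMask (F j), t j)) hc
    (by simp) (by
      intro r hr hk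
      have hk0 := hk
      obtain ⟨v, hv, hk⟩ := hk
      rw [List.mem_ofFn] at hr
      obtain ⟨j, rfl⟩ := hr
      obtain ⟨T, rfl, hT⟩ := htr v hv
      simp only [cmKills, cmMask_and, cmPc_mask hm, Nat.ble_eq] at hk
      have bF := cm_bd w h0 h1 (F j)
      have bO := cm_bd w h0 h1 (F j)ᶜ
      have wO := Finset.sum_add_sum_compl (F j) w
      rw [hsum] at wO
      have hcard : (F j).card + ((F j)ᶜ).card = m := by
        rw [Finset.card_add_card_compl, Fintype.card_fin]
      have htj := ht j
      have htF : t j < (F j).card := by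
        rcases bF with bF | bF
        · have h4 : (t j : ℝ) ≤ 0 := by linarith
          have h5 : t j ≤ 0 := by exact_mod_cast h4
          omega
        · have h4 : (t j : ℝ) < (F j).card := by linarith
          exact_mod_cast h4
      have hO : 0 < ((F j)ᶜ).card := by
        by_contra hz
        have hz : (F j)ᶜ = ∅ := by rw [← Finset.card_eq_zero]; omega
        rw [Finset.compl_eq_empty_iff] at hz
        rw [hz, Finset.inter_univ, hT] at hk
        rw [hz, hsum] at htj
        have : t j ≤ K := by exact_mod_cast htj
        omega
      have bO : 0 < ∑ i ∈ (F j)ᶜ, w i ∧ ∑ i ∈ (F j)ᶜ, w i < ((F j)ᶜ).card := by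
        rcases bO with bO | bO
        · omega
        · exact bO.2
      have htK : t j < K := by
        have : (t j : ℝ) < K := by linarith
        exact_mod_cast this
      simp only [cmRows, List.mem_filter, cmValid,
        Bool.and_eq_true, Nat.ble_eq, cmPc_mask hm, Bool.or_eq_true, List.any_eq_true]
      refine ⟨List.mem_product.2 ⟨List.mem_range.2 (cmMask_lt _), List.mem_range.2 (by omega)⟩, ⟨⟨htK, htF⟩, ?_⟩, hk0⟩
      cases eq with
      | false => left; rfl
      | true =>
        right
        have h6 := het rfl j
        have : (K : ℝ) < t j + ((F j)ᶜ).card := by linarith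
        have : K < t j + ((F j)ᶜ).card := by exact_mod_cast this
        omega)
    (by
      intro r hr s hs
      rw [List.mem_ofFn] at hr hs
      obtain ⟨i, rfl⟩ := hr
      obtain ⟨j, rfl⟩ := hs
      exact cmCompat_of hm eq w h0 h1 hsum _ _ _ _ (ht i) (ht j) (fun h => het h i)
        (fun h => het h j))
  obtain ⟨T, rfl, hT⟩ := htr v hv
  refine ⟨T, hT, fun j => ?_⟩
  have := hvL (cmMask (F j), t j) (by rw [List.mem_ofFn]; exact ⟨j, rfl⟩)
  by_contra hlt
  have h7 : cmKills (cmMask (F j), t j) (cmMask T) = true := by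
    simp only [cmKills, cmMask_and, cmPc_mask hm, Nat.ble_eq]
    omega
  rw [h7] at this
  exact absurd this (by simp)


/-- Rounding along directions: one can move to a point where the functionals taking integer
values have trivial common kernel. -/
theorem cm_vertex {V J : Type*} [AddCommGroup V] [Module ℝ V] [Fintype J]
    (L : J → V →ₗ[ℝ] ℝ) (hinj : ∀ d, (∀ j, L j d = 0) → d = 0) :
    ∀ (N : ℕ) (y : V), (Finset.univ.filter fun j => Int.fract (L j y) ≠ 0).card = N →
    ∃ y', (∀ j, ⌊L j y⌋ ≤ ⌊L j y'⌋ ∧ ⌈L j y'⌉ ≤ ⌈L j y⌉) ∧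
      ∀ d, (∀ j, Int.fract (L j y') = 0 → L j d = 0) → d = 0 := by
  classical
  intro N
  induction N using Nat.strong_induction_on with
  | _ N ih =>
  intro y hN
  by_cases hterm : ∀ d, (∀ j, Int.fract (L j y) = 0 → L j d = 0) → d = 0
  · exact ⟨y, fun j => ⟨le_rfl, le_rfl⟩, hterm⟩
  push Not at hterm
  obtain ⟨d, hd, hd0⟩ := hterm
  let s : J → ℝ := fun j => if 0 < L j d then (⌈L j y⌉ - L j y) / L j d
    else (⌊L j y⌋ - L j y) / L j d
  have hne : (Finset.univ.filter fun j => L j d ≠ 0).Nonempty := by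
    by_contra h
    rw [Finset.not_nonempty_iff_eq_empty, Finset.filter_eq_empty_iff] at h
    exact hd0 (hinj d fun j => by simpa using h (Finset.mem_univ j))
  obtain ⟨j0, hj0, hmin⟩ := Finset.exists_min_image _ s hne
  have hj0' : L j0 d ≠ 0 := by simpa using hj0
  have hspos : 0 ≤ s j0 := by
    simp only [s]
    split_ifs with h
    · exact div_nonneg (by linarith [Int.le_ceil (L j0 y)]) h.le
    · exact div_nonneg_of_nonpos (by linarith [Int.floor_le (L j0 y)]) (not_lt.1 h)
  have hval : ∀ j, L j (y + s j0 • d) = L j y + s j0 * L j d := by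
    intro j; simp
  have hbd : ∀ j, (⌊L j y⌋ : ℝ) ≤ L j (y + s j0 • d) ∧ L j (y + s j0 • d) ≤ ⌈L j y⌉ := by
    intro j
    rw [hval]
    rcases lt_trichotomy (L j d) 0 with h | h | h
    · have h1 : s j0 ≤ s j := hmin j (by simpa using h.ne)
      have h2 : s j * L j d = ⌊L j y⌋ - L j y := by
        simp only [s, if_neg h.not_gt]
        exact div_mul_cancel₀ _ h.ne
      constructor
      · nlinarith
      · nlinarith [Int.le_ceil (L j y)]
    · rw [h]
      constructor
      · linarith [Int.floor_le (L j y)]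
      · linarith [Int.le_ceil (L j y)]
    · have h1 : s j0 ≤ s j := hmin j (by simpa using h.ne')
      have h2 : s j * L j d = ⌈L j y⌉ - L j y := by
        simp only [s, if_pos h]
        exact div_mul_cancel₀ _ h.ne'
      constructor
      · nlinarith [Int.floor_le (L j y)]
      · nlinarith
  have hj0int : Int.fract (L j0 (y + s j0 • d)) = 0 := by
    rw [hval]
    by_cases h : 0 < L j0 d
    · have h2 : L j0 y + s j0 * L j0 d = ⌈L j0 y⌉ := by
        simp only [s, if_pos h]
        field_simp
        ring
      rw [h2]; simp
    · have h2 : L j0 y + s j0 * L j0 d = ⌊L j0 y⌋ := by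
        simp only [s, if_neg h]
        field_simp
        ring
      rw [h2]; simp
  have hlt : (Finset.univ.filter fun j => Int.fract (L j (y + s j0 • d)) ≠ 0).card < N := by
    rw [← hN]
    apply Finset.card_lt_card
    rw [Finset.ssubset_iff_of_subset]
    · refine ⟨j0, ?_, ?_⟩
      · simp only [Finset.mem_filter, Finset.mem_univ, true_and]
        exact fun h => hj0' (hd j0 h)
      · simpa using hj0int
    · intro j
      simp only [Finset.mem_filter, Finset.mem_univ, true_and]
      intro h h'
      apply h
      rw [hval, hd j h', mul_zero, add_zero, h']
  obtain ⟨y', h1, h2⟩ := ih _ hlt (y + s j0 • d) rfl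
  refine ⟨y', fun j => ⟨?_, ?_⟩, h2⟩
  · exact (Int.le_floor.2 (hbd j).1).trans (h1 j).1
  · exact (h1 j).2.trans (Int.ceil_le.2 (hbd j).2)

theorem cm_round {ι : Type*} [Fintype ι] [DecidableEq ι] (F : Fin 5 → Finset ι) (y : ι → ℝ)
    (hsum : Int.fract (∑ R, y R) = 0) :
    ∃ y' : ι → ℝ, (∑ R, y' R = ∑ R, y R) ∧ (∀ R, ⌊y R⌋ ≤ ⌊y' R⌋ ∧ ⌈y' R⌉ ≤ ⌈y R⌉) ∧
      (∀ i, ⌊∑ R ∈ F i, y R⌋ ≤ ⌊∑ R ∈ F i, y' R⌋) ∧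
      ((Finset.univ.filter fun R => Int.fract (y' R) ≠ 0).card ≤ 5 ∨
       ((Finset.univ.filter fun R => Int.fract (y' R) ≠ 0).card = 6 ∧
        ∀ i, Int.fract (∑ R ∈ F i, y' R) = 0)) := by
  classical
  let S : Finset ι → (ι → ℝ) →ₗ[ℝ] ℝ := fun A => ∑ R ∈ A, LinearMap.proj R
  have hS : ∀ A x, S A x = ∑ R ∈ A, x R := by
    intro A x; simp [S]
  let G : Option (Fin 5) → Finset ι := fun o => o.elim Finset.univ F
  let L : ι ⊕ Option (Fin 5) → (ι → ℝ) →ₗ[ℝ] ℝ :=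
    Sum.elim (fun R => LinearMap.proj R) (fun o => S (G o))
  obtain ⟨y', h1, h2⟩ := cm_vertex L (fun d hd => funext fun R => hd (Sum.inl R)) _ y rfl
  have hs := h1 (Sum.inr none)
  simp only [L, Sum.elim_inr, hS, G, Option.elim_none] at hs
  have hsc : (⌈∑ R, y R⌉ : ℝ) = ∑ R, y R ∧ (⌊∑ R, y R⌋ : ℝ) = ∑ R, y R := by
    have h := Int.floor_add_fract (∑ R, y R)
    rw [hsum, add_zero] at h
    rw [← h]; simp
  have hsumeq : ∑ R, y' R = ∑ R, y R := by
    have ha : (⌊∑ R, y R⌋ : ℝ) ≤ ⌊∑ R, y' R⌋ := by exact_mod_cast hs.1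
    have hb : (⌈∑ R, y' R⌉ : ℝ) ≤ ⌈∑ R, y R⌉ := by exact_mod_cast hs.2
    have := Int.floor_le (∑ R, y' R)
    have := Int.le_ceil (∑ R, y' R)
    linarith [hsc.1, hsc.2]
  refine ⟨y', hsumeq, fun R => h1 (Sum.inl R), fun i => ?_, ?_⟩
  · have := (h1 (Sum.inr (some i))).1
    simpa only [L, Sum.elim_inr, hS, G, Option.elim_some] using this
  set M := Finset.univ.filter fun R => Int.fract (y' R) ≠ 0 with hM
  let Q := Finset.univ.filter fun o : Option (Fin 5) => Int.fract (S (G o) y') = 0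
  let E : (M → ℝ) →ₗ[ℝ] (ι → ℝ) := 
    { toFun := fun d R => if h : R ∈ M then d ⟨R, h⟩ else 0
      map_add' := by intro a b; ext R; simp only [Pi.add_apply]; split_ifs <;> simp
      map_smul' := by intro a b; ext R; simp only [Pi.smul_apply]; split_ifs <;> simp }
  let Φ : (M → ℝ) →ₗ[ℝ] (Q → ℝ) := LinearMap.pi fun q => (S (G q.1)).comp E
  have hinj : Function.Injective Φ := by
    rw [← LinearMap.ker_eq_bot, LinearMap.ker_eq_bot']
    intro d hd
    have : E d = 0 := by
      apply h2
      rintro (R | o) hj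
      · have : R ∉ M := by simpa [hM, L] using hj
        show (if h : R ∈ M then d ⟨R, h⟩ else 0) = 0
        rw [dif_neg this]
      · have ho : o ∈ Q := by simpa [Q, L] using hj
        exact congrFun hd ⟨o, ho⟩
    ext ⟨R, hR⟩
    have h3 : (if h : R ∈ M then d ⟨R, h⟩ else 0) = 0 := congrFun this R
    rw [dif_pos hR] at h3
    exact h3
  have hcard := LinearMap.finrank_le_finrank_of_injective hinj
  simp only [Module.finrank_fintype_fun_eq_card, Fintype.card_coe] at hcard
  have hQ : Q.card ≤ 6 := by
    refine (Finset.card_le_univ Q).trans ?_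
    simp
  by_cases h6 : M.card ≤ 5
  · exact Or.inl h6
  · right
    have hQ6 : Q.card = 6 := by omega
    refine ⟨by omega, fun i => ?_⟩
    have : Q = Finset.univ := Finset.eq_univ_of_card _ (by rw [hQ6]; simp)
    have hi : some i ∈ Q := by rw [this]; simp
    simpa [Q, hS, G] using hi

theorem cm_comb_finset {ι : Type*} [DecidableEq ι] (M : Finset ι) (K : ℕ) (f : ι → ℝ)
    (h0 : ∀ R ∈ M, 0 < f R) (h1 : ∀ R ∈ M, f R < 1) (hsum : ∑ R ∈ M, f R = K)
    (F : Fin 5 → Finset ι) (t : Fin 5 → ℕ) (ht : ∀ j, (t j : ℝ) ≤ ∑ R ∈ M ∩ F j, f R)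
    (hM : M.card ≤ 5 ∨ (M.card = 6 ∧ ∀ j, (t j : ℝ) = ∑ R ∈ M ∩ F j, f R)) :
    ∃ T ⊆ M, T.card = K ∧ ∀ j, t j ≤ (T ∩ F j).card := by
  have hK : K ≤ M.card := by
    have : (K : ℝ) ≤ M.card := by
      rw [← hsum]
      calc ∑ R ∈ M, f R ≤ ∑ R ∈ M, (1 : ℝ) := Finset.sum_le_sum fun R hR => (h1 R hR).le
        _ = M.card := by simp
    exact_mod_cast this
  let e : M ≃ Fin M.card := M.equivFin
  let g : Fin M.card ↪ ι := e.symm.toEmbedding.trans (Function.Embedding.subtype _)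
  have hg : ∀ a, g a ∈ M := fun a => (e.symm a).2
  have hgmap : Finset.univ.map g = M := by
    ext R
    simp only [Finset.mem_map, Finset.mem_univ, true_and]
    constructor
    · rintro ⟨a, rfl⟩; exact hg a
    · intro hR; exact ⟨e ⟨R, hR⟩, by simp [g]⟩
  let F' : Fin 5 → Finset (Fin M.card) := fun j => Finset.univ.filter fun a => g a ∈ F j
  have hF' : ∀ j, (F' j).map g = M ∩ F j := by
    intro j
    ext R
    simp only [Finset.mem_map, F', Finset.mem_filter, Finset.mem_univ, true_and, Finset.mem_inter]
    constructor
    · rintro ⟨a, ha, rfl⟩; exact ⟨hg a, ha⟩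
    · rintro ⟨hR, hF⟩
      exact ⟨e ⟨R, hR⟩, by simpa [g] using hF, by simp [g]⟩
  have hsum' : ∑ a, f (g a) = K := by
    rw [← hsum, ← Finset.sum_map Finset.univ g f, hgmap]
  have hs' : ∀ j, ∑ a ∈ F' j, f (g a) = ∑ R ∈ M ∩ F j, f R := by
    intro j
    rw [← hF' j, Finset.sum_map]
  have key : ∃ T : Finset (Fin M.card), T.card = K ∧ ∀ j, t j ≤ (T ∩ F' j).card := by
    rcases hM with hM | ⟨hM, heq⟩
    · exact cm_comb (by omega) false
        (cmCheck5 _ (List.mem_range.2 (by omega)) _ (List.mem_range.2 (by omega)))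
        (fun a => f (g a)) (fun a => h0 _ (hg a)) (fun a => h1 _ (hg a)) hsum' F' t
        (fun j => by rw [hs']; exact ht j) (by simp)
    · exact cm_comb (by omega) true
        (by
          have h6 := cmCheck6 K (List.mem_range.2 (by omega))
          rwa [← hM] at h6)
        (fun a => f (g a)) (fun a => h0 _ (hg a)) (fun a => h1 _ (hg a)) hsum' F' t
        (fun j => by rw [hs']; exact ht j) (fun _ j => by rw [hs']; exact heq j)
  obtain ⟨T, hT, hTF⟩ := key
  refine ⟨T.map g, ?_, by simpa using hT, fun j => (hTF j).trans ?_⟩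
  · intro R hR
    obtain ⟨a, -, rfl⟩ := Finset.mem_map.1 hR
    exact hg a
  · rw [← Finset.card_map g]
    apply Finset.card_le_card
    rw [Finset.map_inter, hF' j]
    exact Finset.inter_subset_inter_left Finset.inter_subset_right

theorem cm_core {ι : Type*} [Fintype ι] [DecidableEq ι] (F : Fin 5 → Finset ι) (y0 : ι → ℝ)
    (hsum0 : Int.fract (∑ R, y0 R) = 0) :
    ∃ z : ι → ℤ, (∀ R, ⌊y0 R⌋ ≤ z R ∧ z R ≤ ⌈y0 R⌉) ∧ ((∑ R, z R : ℤ) : ℝ) = ∑ R, y0 R ∧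
      ∀ i, ⌊∑ R ∈ F i, y0 R⌋ ≤ ∑ R ∈ F i, z R := by
  obtain ⟨y, hs, hb, hF, hcard⟩ := cm_round F y0 hsum0
  rw [← hs] at hsum0 ⊢
  set M := Finset.univ.filter fun R => Int.fract (y R) ≠ 0 with hMdef
  have hfr : ∀ A : Finset ι, ∑ R ∈ A, y R = (∑ R ∈ A, ⌊y R⌋ : ℤ) + ∑ R ∈ M ∩ A, Int.fract (y R) := by
    intro A
    have h1 : ∑ R ∈ M ∩ A, Int.fract (y R) = ∑ R ∈ A, Int.fract (y R) := by
      apply Finset.sum_subset Finset.inter_subset_right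
      intro R hRA hR
      by_contra h
      exact hR (Finset.mem_inter.2 ⟨by simp [hMdef, h], hRA⟩)
    rw [h1]
    push_cast
    rw [← Finset.sum_add_distrib]
    exact Finset.sum_congr rfl fun R _ => (Int.floor_add_fract _).symm
  have hnn : ∀ A : Finset ι, 0 ≤ ∑ R ∈ A, Int.fract (y R) := fun A =>
    Finset.sum_nonneg fun R _ => Int.fract_nonneg _
  have hfl : ∀ A : Finset ι, ⌊∑ R ∈ A, y R⌋ =
      ∑ R ∈ A, ⌊y R⌋ + (⌊∑ R ∈ M ∩ A, Int.fract (y R)⌋₊ : ℤ) := by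
    intro A
    rw [hfr A, Int.floor_intCast_add, Int.natCast_floor_eq_floor (hnn _)]
  have hint : ∀ A : Finset ι, Int.fract (∑ R ∈ A, y R) = 0 →
      ((⌊∑ R ∈ M ∩ A, Int.fract (y R)⌋₊ : ℕ) : ℝ) = ∑ R ∈ M ∩ A, Int.fract (y R) := by
    intro A hA
    rw [hfr A, Int.fract_intCast_add] at hA
    rw [natCast_floor_eq_intCast_floor (hnn _)]
    have := Int.floor_add_fract (∑ R ∈ M ∩ A, Int.fract (y R))
    rw [hA, add_zero] at this
    exact this
  have hM : ∀ R ∈ M, 0 < Int.fract (y R) := by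
    intro R hR
    have h2 : Int.fract (y R) ≠ 0 := by simpa [hMdef] using hR
    exact lt_of_le_of_ne (Int.fract_nonneg _) h2.symm
  have hK := hint Finset.univ hsum0
  rw [Finset.inter_univ] at hK
  obtain ⟨T, hTM, hTK, hTF⟩ := cm_comb_finset M _ (fun R => Int.fract (y R)) hM
    (fun R _ => Int.fract_lt_one _) hK.symm F (fun i => ⌊∑ R ∈ M ∩ F i, Int.fract (y R)⌋₊)
    (fun j => Nat.floor_le (hnn _)) (hcard.imp id fun h => ⟨h.1, fun j => hint _ (h.2 j)⟩)
  have hz : ∀ A : Finset ι, ∑ R ∈ A, (⌊y R⌋ + if R ∈ T then 1 else 0) =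
      ∑ R ∈ A, ⌊y R⌋ + ((T ∩ A).card : ℤ) := by
    intro A
    rw [Finset.sum_add_distrib, Finset.sum_ite_mem, Finset.inter_comm A T]
    simp
  refine ⟨fun R => ⌊y R⌋ + if R ∈ T then 1 else 0, fun R => ⟨?_, ?_⟩, ?_, fun i => ?_⟩
  · have := (hb R).1
    dsimp only
    split_ifs <;> omega
  · refine le_trans ?_ (hb R).2
    dsimp only
    split_ifs with h
    · have h3 := hM R (hTM h)
      have h4 : ⌊y R⌋ < ⌈y R⌉ := by
        rw [Int.lt_ceil]
        have := Int.floor_add_fract (y R)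
        linarith
      omega
    · simpa using Int.floor_le_ceil (y R)
  · rw [hz, Finset.inter_univ, hTK, hfr Finset.univ, Finset.inter_univ, Int.cast_add,
      Int.cast_natCast, hK]
  · refine (hF i).trans ?_
    rw [hz, hfl (F i)]
    have := hTF i
    have : ((⌊∑ R ∈ M ∩ F i, Int.fract (y R)⌋₊ : ℕ) : ℤ) ≤ ((T ∩ F i).card : ℤ) := by
      exact_mod_cast this
    omega

/-- For `n ≤ 5`, every fractional committee `x` for an instance `(c, k)` can be
rounded to an integral committee `x'` with `u_i(x') ≥ ⌊u_i(x)⌋` for all voters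
`i` and `⌊x_R⌋ ≤ x'_R ≤ ⌈x_R⌉` for all candidate types `R`. -/
theorem stmt14 (n : ℕ) (hn : n ≤ 5) (c : Typ n → ℕ) (k : ℕ)
    (x : Typ n → ℝ) (hx : IsFracCommittee c k x) :
    ∃ x' : Typ n → ℕ, IsIntCommittee c k x' ∧
      (∀ i : Fin n, ⌊fracUtil x i⌋ ≤ intUtil x' i) ∧
      (∀ R : Typ n, ⌊x R⌋ ≤ (x' R : ℤ) ∧ (x' R : ℤ) ≤ ⌈x R⌉) := by
  classical
  obtain ⟨hx0, hxc, hxk⟩ := hx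
  let y : Option (Typ n) → ℝ := fun o => o.elim ((k : ℝ) - ∑ R, x R) x
  let F : Fin 5 → Finset (Option (Typ n)) := fun i =>
    Finset.univ.filter fun o => ∃ R : Typ n, o = some R ∧ ∃ h : (i : ℕ) < n, (⟨i, h⟩ : Fin n) ∈ R.1
  have hysum : ∑ o, y o = k := by
    rw [Fintype.sum_option]
    simp [y]
  obtain ⟨z, hz1, hz2, hz3⟩ := cm_core F y (by rw [hysum]; simp)
  have hz0 : ∀ R : Typ n, 0 ≤ z (some R) := fun R =>
    (Int.floor_nonneg.2 (hx0 R)).trans (hz1 (some R)).1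
  have hcast : ∀ R : Typ n, ((z (some R)).toNat : ℤ) = z (some R) := fun R =>
    Int.toNat_of_nonneg (hz0 R)
  refine ⟨fun R => (z (some R)).toNat, ⟨fun R => ?_, ?_⟩, fun i => ?_, fun R => ?_⟩
  · have h1 : z (some R) ≤ ⌈x R⌉ := (hz1 (some R)).2
    have h2 : ⌈x R⌉ ≤ (c R : ℤ) := Int.ceil_le.2 (by simpa using hxc R)
    dsimp only
    omega
  · have h1 : 0 ≤ z none := (Int.floor_nonneg.2 (sub_nonneg.2 hxk)).trans (hz1 none).1
    rw [hysum] at hz2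
    have h2 : ∑ o, z o = (k : ℤ) := by exact_mod_cast hz2
    rw [Fintype.sum_option] at h2
    have h3 : ((∑ R : Typ n, (z (some R)).toNat : ℕ) : ℤ) = ∑ R : Typ n, z (some R) := by
      rw [Nat.cast_sum]
      exact Finset.sum_congr rfl fun R _ => hcast R
    dsimp only
    omega
  · have hmem : ∀ R : Typ n, some R ∈ F ⟨i, by omega⟩ ↔ i ∈ R.1 := by
      intro R
      simp [F]
    have hnone : none ∉ F ⟨i, by omega⟩ := by simp [F]
    have h1 := hz3 ⟨i, by omega⟩
    have e1 : ∑ o ∈ F ⟨i, by omega⟩, y o = fracUtil x i := by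
      rw [← Finset.univ_inter (F ⟨i, by omega⟩), ← Finset.sum_ite_mem, Fintype.sum_option,
        if_neg hnone, zero_add]
      simp only [hmem]
      rfl
    have e2 : ∑ o ∈ F ⟨i, by omega⟩, z o = intUtil (fun R => (z (some R)).toNat) i := by
      rw [← Finset.univ_inter (F ⟨i, by omega⟩), ← Finset.sum_ite_mem, Fintype.sum_option,
        if_neg hnone, zero_add]
      simp only [hmem, intUtil, hcast]
    rwa [e1, e2] at h1
  · dsimp only
    rw [hcast]
    exact hz1 (some R)
end

section
/- For n ≤ 5 voters, the core of every instance (c,k,b) is non-empty: there exists an integral committee x with Σ_R x_R ≤ k and x_R ≤ c_R such that no non-empty coalition S ⊆ N admits an integral committee y of size at most Σ_{i∈S} b_i (respecting supplies) with u_i(y) > u_i(x) for all i ∈ S. -/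
/-- Integral committee affordable for coalition `S` given budgets `b`. -/
def IsIntAffordable {n : ℕ} (c : Typ n → ℕ) (b : Fin n → ℚ) (S : Finset (Fin n))
    (x : Typ n → ℕ) : Prop :=
  (∀ R, x R ≤ c R) ∧ (∑ R : Typ n, (x R : ℚ)) ≤ ∑ i ∈ S, b i

/-- Fractional committee affordable for coalition `S` given budgets `b`. -/
def IsFracAffordable {n : ℕ} (c : Typ n → ℕ) (b : Fin n → ℚ) (S : Finset (Fin n))
    (x : Typ n → ℝ) : Prop :=
  (∀ R, 0 ≤ x R) ∧ (∀ R, x R ≤ (c R : ℝ)) ∧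
    (∑ R : Typ n, x R) ≤ ((∑ i ∈ S, b i : ℚ) : ℝ)

/-- `x` is an integral committee in the core of `(c, k, b)`. -/
def InCore {n : ℕ} (c : Typ n → ℕ) (k : ℕ) (b : Fin n → ℚ) (x : Typ n → ℕ) : Prop :=
  IsIntCommittee c k x ∧
  ¬ ∃ (S : Finset (Fin n)) (y : Typ n → ℕ), S.Nonempty ∧ IsIntAffordable c b S y ∧
      ∀ i ∈ S, intUtil x i < intUtil y i

/-- The fractional core of `(c, k, b)` is non-empty. -/
def FracCoreNonempty {n : ℕ} (c : Typ n → ℕ) (k : ℕ) (b : Fin n → ℚ) : Prop :=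
  ∃ x : Typ n → ℝ, IsFracCommittee c k x ∧
    ¬ ∃ (S : Finset (Fin n)) (y : Typ n → ℝ), S.Nonempty ∧ IsFracAffordable c b S y ∧
        ∀ i ∈ S, fracUtil x i < fracUtil y i


theorem pair_lemma {V : Type*} [DecidableEq V] {n : ℕ} (hn : n ≤ 5) (F : Finset V) (w : V → ℝ)
    (hw : ∀ p ∈ F, 0 < w p) (hF : 2 ≤ F.card) (E : Fin n → Finset V) (hE : ∀ i, E i ⊆ F)
    (hh : ∀ i, ∑ p ∈ E i, w p ≤ (∑ p ∈ F, w p) / 2) :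
    ∃ p ∈ F, ∃ q ∈ F, p ≠ q ∧ ∀ i, ¬ (p ∈ E i ∧ q ∈ E i) := by
  by_contra hcon
  have hcov : ∀ p ∈ F, ∀ q ∈ F, p ≠ q → ∃ i, p ∈ E i ∧ q ∈ E i := by
    intro p hp q hq hpq
    by_contra h
    exact hcon ⟨p, hp, q, hq, hpq, fun i hi => h ⟨i, hi⟩⟩
  have hdeg : ∀ p ∈ F, 3 ≤ (Finset.univ.filter (fun i => p ∈ E i)).card := by
    intro p hp
    by_contra hlt
    obtain ⟨q, hq, hqp⟩ := Finset.exists_mem_ne (by omega : 1 < F.card) p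
    obtain ⟨i, hi, -⟩ := hcov p hp q hq hqp.symm
    set s := Finset.univ.filter (fun i => p ∈ E i) with hs
    have his : i ∈ s := by simp [hs, hi]
    have hc : (s.erase i).card ≤ 1 := by
      rw [Finset.card_erase_of_mem his]; omega
    have hj : ∃ j, p ∈ E j ∧ ∀ l, p ∈ E l → l = i ∨ l = j := by
      rcases Finset.eq_empty_or_nonempty (s.erase i) with h0 | ⟨j, hj⟩
      · refine ⟨i, hi, fun l hl => ?_⟩
        by_contra hne
        have : l ∈ s.erase i := by
          simp [hs, hl]; tauto
        simp [h0] at this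
      · refine ⟨j, ?_, fun l hl => ?_⟩
        · have := (Finset.mem_erase.1 hj).2
          simpa [hs] using this
        · by_cases hli : l = i
          · exact Or.inl hli
          · right
            exact Finset.card_le_one.1 hc l (by simp [hs, hl, hli]) j hj
    obtain ⟨j, hpj, hj⟩ := hj
    have hu : E i ∪ E j = F := by
      apply Finset.Subset.antisymm (Finset.union_subset (hE i) (hE j))
      intro r hr
      by_cases hrp : r = p
      · subst hrp; exact Finset.mem_union_left _ hi
      · obtain ⟨l, hl, hrl⟩ := hcov p hp r hr (Ne.symm hrp)
        rcases hj l hl with rfl | rfl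
        · exact Finset.mem_union_left _ hrl
        · exact Finset.mem_union_right _ hrl
    have h1 := Finset.sum_union_inter (s₁ := E i) (s₂ := E j) (f := w)
    rw [hu] at h1
    have h2 : 0 < ∑ r ∈ E i ∩ E j, w r := by
      apply Finset.sum_pos
      · intro r hr; exact hw r (hE i (Finset.mem_inter.1 hr).1)
      · exact ⟨p, Finset.mem_inter.2 ⟨hi, hpj⟩⟩
    linarith [hh i, hh j]
  have hpos : 0 < ∑ p ∈ F, w p := Finset.sum_pos hw (Finset.card_pos.1 (by omega))
  have h1 : ∑ i, ∑ p ∈ E i, w p = ∑ p ∈ F, w p * ((Finset.univ.filter (fun i => p ∈ E i)).card : ℝ) := by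
    have : ∀ i, ∑ p ∈ E i, w p = ∑ p ∈ F, if p ∈ E i then w p else 0 := by
      intro i
      rw [← Finset.sum_filter, Finset.filter_mem_eq_inter, Finset.inter_eq_right.2 (hE i)]
    simp_rw [this]
    rw [Finset.sum_comm]
    refine Finset.sum_congr rfl fun p _ => ?_
    rw [← Finset.sum_filter, Finset.sum_const, nsmul_eq_mul, mul_comm]
  have h2 : 3 * ∑ p ∈ F, w p ≤ ∑ p ∈ F, w p * ((Finset.univ.filter (fun i => p ∈ E i)).card : ℝ) := by
    rw [Finset.mul_sum]
    refine Finset.sum_le_sum fun p hp => ?_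
    have : (3 : ℝ) ≤ ((Finset.univ.filter (fun i => p ∈ E i)).card : ℝ) := by
      exact_mod_cast hdeg p hp
    nlinarith [hw p hp]
  have h3 : ∑ i, ∑ p ∈ E i, w p ≤ ∑ _i : Fin n, (∑ p ∈ F, w p) / 2 :=
    Finset.sum_le_sum fun i _ => hh i
  rw [Finset.sum_const, Finset.card_univ, Fintype.card_fin, nsmul_eq_mul] at h3
  have h4 : (n : ℝ) ≤ 5 := by exact_mod_cast hn
  nlinarith

theorem round_lemma {V : Type*} [DecidableEq V] {n : ℕ} (hn : n ≤ 5) (F : Finset V) (f : V → ℝ)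
    (hf0 : ∀ p ∈ F, 0 < f p) (hf1 : ∀ p ∈ F, f p < 1) (hF : F.card ≤ 5)
    (D : Fin n → Finset V) (hD : ∀ i, D i ⊆ F)
    (v : Fin n → ℤ) (hv : ∀ i, (v i : ℝ) ≤ ∑ p ∈ D i, f p) (K : ℤ) (hK : ∑ p ∈ F, f p ≤ K) :
    ∃ P ⊆ F, (P.card : ℤ) ≤ K ∧ ∀ i, v i ≤ ((P ∩ D i).card : ℤ) := by
  have hle : ∀ i, v i ≤ (D i).card := by
    intro i
    have : ∑ p ∈ D i, f p ≤ ∑ p ∈ D i, (1 : ℝ) :=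
      Finset.sum_le_sum fun p hp => (hf1 p (hD i hp)).le
    simp at this
    exact_mod_cast (hv i).trans this
  have hlt : ∀ i, (D i).Nonempty → v i + 1 ≤ (D i).card := by
    intro i hne
    have : ∑ p ∈ D i, f p < ∑ p ∈ D i, (1 : ℝ) :=
      Finset.sum_lt_sum_of_nonempty hne fun p hp => hf1 p (hD i hp)
    simp at this
    have h2 := (hv i).trans_lt this
    have : v i < ((D i).card : ℤ) := by exact_mod_cast h2
    omega
  have hsub : ∀ i, D i ≠ F → ∑ p ∈ D i, f p < ∑ p ∈ F, f p := by
    intro i hne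
    obtain ⟨r, hr, hrD⟩ := Finset.exists_of_ssubset ((hD i).ssubset_of_ne hne)
    exact Finset.sum_lt_sum_of_subset (hD i) hr hrD (hf0 r hr) fun j hj _ => (hf0 j hj).le
  have hle0 : ∀ i, v i ≤ K := by
    intro i
    have : ∑ p ∈ D i, f p ≤ ∑ p ∈ F, f p :=
      Finset.sum_le_sum_of_subset_of_nonneg (hD i) fun j hj _ => (hf0 j hj).le
    exact_mod_cast (hv i).trans (this.trans hK)
  have hltK : ∀ i, D i ≠ F → v i < K := by
    intro i hi
    exact_mod_cast (hv i).trans_lt ((hsub i hi).trans_le hK)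
  by_cases h1 : (F.card : ℤ) ≤ K
  · refine ⟨F, subset_rfl, h1, fun i => ?_⟩
    rw [Finset.inter_eq_right.2 (hD i)]
    exact hle i
  have hFne : F.Nonempty := by
    by_contra h
    rw [Finset.not_nonempty_iff_eq_empty] at h
    subst h
    simp at hK h1
    have : (0 : ℤ) ≤ K := by exact_mod_cast hK
    omega
  have hK1 : 1 ≤ K := by
    have : (0 : ℝ) < K := (Finset.sum_pos hf0 hFne).trans_le hK
    have : (0 : ℤ) < K := by exact_mod_cast this
    omega
  by_cases h2 : (F.card : ℤ) - 1 ≤ K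
  · obtain ⟨r, hr⟩ := hFne
    refine ⟨F.erase r, Finset.erase_subset _ _, ?_, fun i => ?_⟩
    · rw [Finset.card_erase_of_mem hr]; omega
    · rw [Finset.erase_inter, Finset.inter_eq_right.2 (hD i)]
      have := Finset.pred_card_le_card_erase (s := D i) (a := r)
      rcases Finset.eq_empty_or_nonempty (D i) with h | h
      · have := hle i
        simp [h] at this ⊢
        exact this
      · have := hlt i h
        omega
  by_cases h3 : K = 1
  · obtain ⟨r, hr⟩ := hFne
    refine ⟨{r}, by simpa using hr, by simp [h3], fun i => ?_⟩
    by_cases hDF : D i = F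
    · rw [hDF, Finset.inter_eq_left.2 (by simpa using hr)]
      simpa [h3] using hle0 i
    · have := hltK i hDF
      omega
  by_cases h4 : K = 2
  · obtain ⟨p, hp, q, hq, hpq, h⟩ := pair_lemma hn F f hf0 (by omega)
      (fun i => if v i = 1 then F \ D i else ∅)
      (by intro i; split_ifs <;> simp)
      (by
        intro i
        have hpos : 0 < ∑ p ∈ F, f p := Finset.sum_pos hf0 hFne
        split_ifs with hi
        · have h5 := Finset.sum_sdiff (f := f) (hD i)
          have h6 := hv i
          rw [hi] at h6
          rw [h4] at hK
          push_cast at h6 hK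
          linarith
        · simp; linarith)
    have hPF : ({p, q} : Finset V) ⊆ F := by
      intro r hr; simp at hr; rcases hr with rfl | rfl <;> assumption
    refine ⟨{p, q}, hPF, by rw [Finset.card_pair hpq, h4]; rfl, fun i => ?_⟩
    by_cases hDF : D i = F
    · rw [hDF, Finset.inter_eq_left.2 hPF, Finset.card_pair hpq]
      have := hle0 i
      push_cast; omega
    · have h5 := hltK i hDF
      by_cases hi : v i = 1
      · have h6 := h i
        simp only [hi, if_true, Finset.mem_sdiff, hp, hq, true_and] at h6
        have : 0 < (({p, q} : Finset V) ∩ D i).card := by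
          rw [Finset.card_pos]
          by_cases hpD : p ∈ D i
          · exact ⟨p, by simp [hpD]⟩
          · have hqD : q ∈ D i := by tauto
            exact ⟨q, by simp [hqD]⟩
        omega
      · omega
  · have h5 : K = F.card - 2 := by omega
    obtain ⟨p, hp, q, hq, hpq, h⟩ := pair_lemma hn F (fun r => 1 - f r)
      (fun r hr => by linarith [hf1 r hr]) (by omega)
      (fun i => if v i = (D i).card - 1 then D i else ∅)
      (by intro i; split_ifs; exacts [hD i, by simp])
      (by
        intro i
        have h6 : (2 : ℝ) ≤ ∑ r ∈ F, (1 - f r) := by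
          rw [Finset.sum_sub_distrib]
          rw [h5] at hK
          simp at hK ⊢
          linarith
        split_ifs with hi
        · have h7 := hv i
          rw [hi] at h7
          rw [Finset.sum_sub_distrib (s := D i)]
          push_cast at h7
          simp only [Finset.sum_const, nsmul_eq_mul, mul_one]
          linarith
        · simp only [Finset.sum_empty]; linarith)
    have hPF : ({p, q} : Finset V) ⊆ F := by
      intro r hr; simp at hr; rcases hr with rfl | rfl <;> assumption
    refine ⟨F \ {p, q}, Finset.sdiff_subset, ?_, fun i => ?_⟩
    · rw [Finset.card_sdiff_of_subset hPF, Finset.card_pair hpq]; omega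
    · have h6 : (F \ {p, q}) ∩ D i = D i \ ({p, q} ∩ D i) := by
        ext r; simp only [Finset.mem_inter, Finset.mem_sdiff]
        have := @hD i r
        tauto
      rw [h6, Finset.card_sdiff_of_subset Finset.inter_subset_right]
      have h7 : (({p, q} : Finset V) ∩ D i).card ≤ 2 := by
        rw [← Finset.card_pair hpq]; exact Finset.card_le_card Finset.inter_subset_left
      rcases Finset.eq_empty_or_nonempty (D i) with h0 | h0
      · have := hle i
        simp [h0] at this ⊢
        exact this
      · have h8 := hlt i h0
        by_cases hi : v i = (D i).card - 1
        · have h9 := h i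
          simp only [hi, if_true] at h9
          have : (({p, q} : Finset V) ∩ D i).card ≤ 1 := by
            rw [Finset.card_le_one]
            intro a ha b hb
            simp at ha hb
            obtain ⟨ha | ha, ha'⟩ := ha <;> obtain ⟨hb | hb, hb'⟩ := hb <;> subst ha <;> subst hb <;>
              first | rfl | (exfalso; tauto)
          omega
        · omega

theorem hit_boundary {V : Type*} [DecidableEq V] (F : Finset V) (f d : V → ℝ)
    (hf0 : ∀ p ∈ F, 0 < f p) (hf1 : ∀ p ∈ F, f p < 1) (hd : ∃ p ∈ F, d p ≠ 0) :
    ∃ t : ℝ, 0 ≤ t ∧ (∀ p ∈ F, 0 ≤ f p + t * d p ∧ f p + t * d p ≤ 1) ∧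
      ∃ p ∈ F, f p + t * d p = 0 ∨ f p + t * d p = 1 := by
  set τ : V → ℝ := fun p => if 0 < d p then (1 - f p) / d p else f p / (- d p) with hτ
  obtain ⟨p, hp, hmin⟩ := Finset.exists_min_image (F.filter (fun p => d p ≠ 0)) τ
    (by obtain ⟨p, hp, h⟩ := hd; exact ⟨p, by simp [hp, h]⟩)
  simp only [Finset.mem_filter] at hp hmin
  have hpos : 0 ≤ τ p := by
    simp only [hτ]
    split_ifs with h
    · exact div_nonneg (by linarith [hf1 p hp.1]) h.le
    · exact div_nonneg (hf0 p hp.1).le (by linarith)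
  refine ⟨τ p, hpos, fun q hq => ?_, p, hp.1, ?_⟩
  · by_cases hq0 : d q = 0
    · simp [hq0, (hf0 q hq).le, (hf1 q hq).le]
    have h := hmin q ⟨hq, hq0⟩
    have h0 := hf0 q hq
    have h1 := hf1 q hq
    by_cases hqd : 0 < d q
    · have h2 : τ q = (1 - f q) / d q := by simp [hτ, hqd]
      rw [h2, le_div_iff₀ hqd] at h
      constructor
      · positivity
      · linarith
    · have h2 : τ q = f q / (- d q) := by simp [hτ, hqd]
      have hneg : 0 < - d q := by
        have := lt_of_le_of_ne (not_lt.1 hqd) hq0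
        linarith
      rw [h2, le_div_iff₀ hneg] at h
      constructor
      · linarith
      · nlinarith
  · by_cases hpd : 0 < d p
    · right
      have h2 : τ p = (1 - f p) / d p := by simp [hτ, hpd]
      rw [h2, div_mul_cancel₀ _ hp.2]; ring
    · left
      have h2 : τ p = f p / (- d p) := by simp [hτ, hpd]
      rw [h2]; field_simp [hp.2]; ring

theorem exists_kernel {n : ℕ} (F : Finset (Typ n)) (hF : n < F.card) :
    ∃ d : Typ n → ℝ, (∀ R, R ∉ F → d R = 0) ∧ (∃ R ∈ F, d R ≠ 0) ∧
      (∀ i, fracUtil d i = 0) ∧ ∑ R, d R ≤ 0 := by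
  let L : (F → ℝ) →ₗ[ℝ] (Fin n → ℝ) :=
    { toFun := fun g i => ∑ R : F, if i ∈ R.1.1 then g R else 0
      map_add' := by
        intro g h; ext i
        simp only [Pi.add_apply, ← Finset.sum_add_distrib]
        refine Finset.sum_congr rfl fun R _ => ?_
        split_ifs <;> simp
      map_smul' := by
        intro a g; ext i
        simp only [Pi.smul_apply, smul_eq_mul, RingHom.id_apply, Finset.mul_sum]
        refine Finset.sum_congr rfl fun R _ => ?_
        split_ifs <;> simp }
  have hker := LinearMap.ker_ne_bot_of_finrank_lt (f := L) (by simpa using hF)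
  obtain ⟨g, hg, hg0⟩ := Submodule.exists_mem_ne_zero_of_ne_bot hker
  rw [LinearMap.mem_ker] at hg
  have key : ∃ g : F → ℝ, g ≠ 0 ∧ L g = 0 ∧ ∑ R, g R ≤ 0 := by
    by_cases hs : ∑ R, g R ≤ 0
    · exact ⟨g, hg0, hg, hs⟩
    · refine ⟨-g, by simpa using hg0, by simp [hg], ?_⟩
      simp only [Pi.neg_apply, Finset.sum_neg_distrib]; linarith
  clear hg hg0 g
  obtain ⟨g, hg0, hg, hs⟩ := key
  set d : Typ n → ℝ := fun R => if h : R ∈ F then g ⟨R, h⟩ else 0 with hdd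
  have hd0 : ∀ R, R ∉ F → d R = 0 := fun R hR => by simp [hdd, hR]
  have hd1 : ∀ R : F, d R.1 = g R := fun R => by simp [hdd]
  refine ⟨d, hd0, ?_, fun i => ?_, ?_⟩
  · by_contra hcon
    push Not at hcon
    exact hg0 (funext fun R => by rw [← hd1]; exact hcon R.1 R.2)
  · have h1 := congrFun hg i
    simp only [L, LinearMap.coe_mk, AddHom.coe_mk, Pi.zero_apply] at h1
    unfold fracUtil
    refine Eq.trans ?_ h1
    rw [← Finset.sum_subset (Finset.subset_univ F), ← Finset.sum_coe_sort F]
    · refine Finset.sum_congr rfl fun R _ => ?_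
      rw [hd1]
    · intro R _ hR; simp [hd0 R hR]
  · rw [← Finset.sum_subset (Finset.subset_univ F) (fun R _ hR => hd0 R hR), ← Finset.sum_coe_sort F]
    simpa [hd1] using hs

theorem few_frac {n : ℕ} (c : Typ n → ℕ) (k : ℕ) (u : Fin n → ℤ) : ∀ (N : ℕ) (x : Typ n → ℝ),
    (Finset.univ.filter (fun R => Int.fract (x R) ≠ 0)).card = N →
    IsFracCommittee c k x → (∀ i, (u i : ℝ) ≤ fracUtil x i) →
    ∃ x : Typ n → ℝ, IsFracCommittee c k x ∧ (∀ i, (u i : ℝ) ≤ fracUtil x i) ∧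
      (Finset.univ.filter (fun R => Int.fract (x R) ≠ 0)).card ≤ n := by
  intro N
  induction N using Nat.strong_induction_on with
  | _ N ih =>
  intro x hN hx hu
  by_cases hle : N ≤ n
  · exact ⟨x, hx, hu, hN ▸ hle⟩
  set F := Finset.univ.filter (fun R => Int.fract (x R) ≠ 0) with hFdef
  have hmem : ∀ R, R ∈ F ↔ Int.fract (x R) ≠ 0 := fun R => by simp [hFdef]
  obtain ⟨d, hd0, hd1, hdu, hds⟩ := exists_kernel F (by omega)
  obtain ⟨t, ht, htb, p, hp, hpt⟩ := hit_boundary F (fun R => Int.fract (x R)) d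
    (fun R hR => lt_of_le_of_ne (Int.fract_nonneg _) (Ne.symm ((hmem R).1 hR)))
    (fun R _ => Int.fract_lt_one _) hd1
  have hxe : ∀ R, x R + t * d R = ⌊x R⌋ + (Int.fract (x R) + t * d R) := by
    intro R; rw [← add_assoc, Int.floor_add_fract]
  have hfl0 : ∀ R, (0 : ℝ) ≤ (⌊x R⌋ : ℝ) := fun R => by
    exact_mod_cast Int.floor_nonneg.2 (hx.1 R)
  set x' : Typ n → ℝ := fun R => x R + t * d R with hx'
  have hnotF : ∀ R, R ∉ F → x' R = x R := fun R hR => by simp [hx', hd0 R hR]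
  have hx'c : IsFracCommittee c k x' := by
    refine ⟨fun R => ?_, fun R => ?_, ?_⟩
    · by_cases hR : R ∈ F
      · have := (htb R hR).1
        simp only [hx']; rw [hxe]; linarith [hfl0 R]
      · rw [hnotF R hR]; exact hx.1 R
    · by_cases hR : R ∈ F
      · have h1 := (htb R hR).2
        simp only [hx']; rw [hxe]
        have h2 : (⌊x R⌋ : ℝ) < c R := by
          have h3 := hx.2.1 R
          have h4 := lt_of_le_of_ne (Int.fract_nonneg (x R)) (Ne.symm ((hmem R).1 hR))
          have h5 := Int.floor_add_fract (x R)
          linarith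
        have h3 : ⌊x R⌋ < (c R : ℤ) := by exact_mod_cast h2
        have h4 : ⌊x R⌋ + 1 ≤ (c R : ℤ) := h3
        have h5 : (⌊x R⌋ : ℝ) + 1 ≤ c R := by exact_mod_cast h4
        linarith
      · rw [hnotF R hR]; exact hx.2.1 R
    · simp only [hx', Finset.sum_add_distrib, ← Finset.mul_sum]
      nlinarith [hx.2.2]
  have hx'u : ∀ i, (u i : ℝ) ≤ fracUtil x' i := by
    intro i
    have : fracUtil x' i = fracUtil x i + t * fracUtil d i := by
      unfold fracUtil
      rw [Finset.mul_sum, ← Finset.sum_add_distrib]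
      refine Finset.sum_congr rfl fun R _ => ?_
      split_ifs <;> simp [hx']
    rw [this, hdu i]; simpa using hu i
  refine ih _ ?_ x' rfl hx'c hx'u
  rw [← hN]
  apply Finset.card_lt_card
  rw [Finset.ssubset_iff_of_subset]
  · refine ⟨p, hp, ?_⟩
    simp only [Finset.mem_filter, Finset.mem_univ, true_and, not_not, hx']
    rw [hxe]
    rcases hpt with h | h
    · rw [h]; simp
    · rw [h]; simp
  · intro R hR
    simp only [Finset.mem_filter, Finset.mem_univ, true_and] at hR
    by_contra hRF
    rw [hnotF R hRF] at hR
    exact hRF ((hmem R).2 hR)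

theorem sum_split {n : ℕ} (x : Typ n → ℝ) :
    ∑ R, x R = ∑ R, (⌊x R⌋ : ℝ) +
      ∑ R ∈ Finset.univ.filter (fun R => Int.fract (x R) ≠ 0), Int.fract (x R) := by
  rw [Finset.sum_filter_ne_zero, ← Finset.sum_add_distrib]
  exact Finset.sum_congr rfl fun R _ => (Int.floor_add_fract _).symm

theorem integralizable_of_le_five {n : ℕ} (hn : n ≤ 5) (c : Typ n → ℕ) (k : ℕ) :
    Integralizable c k := by
  intro u ⟨x, hx, hu⟩
  obtain ⟨x, hx, hu, hcard⟩ := few_frac c k u _ x rfl hx hu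
  set F := Finset.univ.filter (fun R => Int.fract (x R) ≠ 0) with hFdef
  have hmem : ∀ R, R ∈ F ↔ Int.fract (x R) ≠ 0 := fun R => by simp [hFdef]
  have hpos : ∀ R ∈ F, 0 < Int.fract (x R) := fun R hR =>
    lt_of_le_of_ne (Int.fract_nonneg _) (Ne.symm ((hmem R).1 hR))
  have hfl : ∀ R, 0 ≤ ⌊x R⌋ := fun R => Int.floor_nonneg.2 (hx.1 R)
  obtain ⟨P, hPF, hPK, hP⟩ := round_lemma hn F (fun R => Int.fract (x R)) hpos
    (fun R _ => Int.fract_lt_one _) (hcard.trans hn)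
    (fun i => F.filter (fun R => i ∈ R.1)) (fun i => Finset.filter_subset _ _)
    (fun i => u i - ∑ R : Typ n, if i ∈ R.1 then ⌊x R⌋ else 0)
    (by
      intro i
      have h1 : fracUtil x i = (∑ R : Typ n, if i ∈ R.1 then (⌊x R⌋ : ℝ) else 0) +
          ∑ R ∈ F.filter (fun R => i ∈ R.1), Int.fract (x R) := by
        unfold fracUtil
        rw [Finset.filter_comm, Finset.sum_filter_ne_zero, Finset.sum_filter,
          ← Finset.sum_add_distrib]
        refine Finset.sum_congr rfl fun R _ => ?_
        split_ifs
        · exact (Int.floor_add_fract _).symm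
        · simp
      have h2 := hu i
      push_cast
      linarith)
    (k - ∑ R, ⌊x R⌋)
    (by
      have h1 := sum_split x
      have h2 := hx.2.2
      push_cast
      linarith)
  have hz : ∀ R, ((⌊x R⌋.toNat + if R ∈ P then 1 else 0 : ℕ) : ℤ) = ⌊x R⌋ + if R ∈ P then 1 else 0 := by
    intro R
    push_cast
    rw [Int.toNat_of_nonneg (hfl R)]
  refine ⟨fun R => ⌊x R⌋.toNat + if R ∈ P then 1 else 0, ⟨fun R => ?_, ?_⟩, fun i => ?_⟩
  · zify
    have h := hz R
    push_cast at h
    rw [h]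
    have h1 := hx.2.1 R
    have h2 := Int.floor_add_fract (x R)
    split_ifs with hR
    · have h3 := hpos R (hPF hR)
      have h4 : (⌊x R⌋ : ℝ) < (c R : ℤ) := by push_cast; linarith
      have h5 : ⌊x R⌋ < (c R : ℤ) := by exact_mod_cast h4
      omega
    · have h3 := Int.fract_nonneg (x R)
      have h4 : (⌊x R⌋ : ℝ) ≤ (c R : ℤ) := by push_cast; linarith
      have h5 : ⌊x R⌋ ≤ (c R : ℤ) := by exact_mod_cast h4
      omega
  · have h1 : ((∑ R, (⌊x R⌋.toNat + if R ∈ P then 1 else 0) : ℕ) : ℤ) =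
        ∑ R, ⌊x R⌋ + (P.card : ℤ) := by
      rw [Nat.cast_sum, Finset.sum_congr rfl fun R _ => hz R, Finset.sum_add_distrib]
      simp
    have h2 : ((∑ R, (⌊x R⌋.toNat + if R ∈ P then 1 else 0) : ℕ) : ℤ) ≤ k := by
      rw [h1]; linarith
    exact_mod_cast h2
  · have h1 : intUtil (fun R => ⌊x R⌋.toNat + if R ∈ P then 1 else 0) i =
        (∑ R : Typ n, if i ∈ R.1 then ⌊x R⌋ else 0) +
          ((P ∩ F.filter (fun R => i ∈ R.1)).card : ℤ) := by
      have h2 : P ∩ F.filter (fun R => i ∈ R.1) =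
          Finset.univ.filter (fun R => i ∈ R.1 ∧ R ∈ P) := by
        ext R
        simp only [Finset.mem_inter, Finset.mem_filter, Finset.mem_univ, true_and]
        have := @hPF R
        tauto
      unfold intUtil
      rw [h2, Finset.card_filter, Nat.cast_sum, ← Finset.sum_add_distrib]
      refine Finset.sum_congr rfl fun R _ => ?_
      rw [hz R]
      by_cases h3 : i ∈ R.1 <;> by_cases h4 : R ∈ P <;> simp [h3, h4]
    rw [h1]
    linarith [hP i]

theorem exists_h (ε : ℝ) (h0 : 0 < ε) (h1 : ε < 1 / 2) :
    ∃ h : ℝ → ℝ, Continuous h ∧ (∀ A, 0 ≤ h A) ∧ (∀ A, 0 < A → A * h A ≤ 1) ∧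
      (∀ A, 1 ≤ A → A * h A = 1) ∧ (∀ A, 0 < h A → 1 - ε ≤ A) := by
  have hpos : ∀ A : ℝ, 0 < max A (1 / 2) := fun A => lt_max_of_lt_right (by norm_num)
  refine ⟨fun A => max 0 (min 1 ((A - (1 - ε)) / ε)) / max A (1 / 2), ?_, ?_, ?_, ?_, ?_⟩
  · refine Continuous.div (by fun_prop) (by fun_prop) fun A => (hpos A).ne'
  · intro A
    exact div_nonneg (le_max_left _ _) (hpos A).le
  · intro A hA
    rw [← mul_div_assoc, div_le_one (hpos A)]
    have h2 : max 0 (min 1 ((A - (1 - ε)) / ε)) ≤ 1 := max_le (by norm_num) (min_le_left _ _)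
    have h3 : A ≤ max A (1 / 2) := le_max_left _ _
    nlinarith
  · intro A hA
    have h2 : 1 ≤ (A - (1 - ε)) / ε := by
      rw [le_div_iff₀ h0]; linarith
    simp only []
    rw [min_eq_left h2, max_eq_right zero_le_one, max_eq_left (by linarith)]
    field_simp
  · intro A hA
    by_contra hlt
    have h2 : (A - (1 - ε)) / ε ≤ 0 := div_nonpos_of_nonpos_of_nonneg (by linarith) h0.le
    have h3 : max 0 (min 1 ((A - (1 - ε)) / ε)) = 0 :=
      max_eq_left ((min_le_right _ _).trans h2)
    simp only [h3, zero_div, lt_irrefl] at hA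

theorem deriv_nonneg_right (φ : ℝ → ℝ) (D p r : ℝ) (hφ : HasDerivAt φ D p) (hpr : p < r)
    (hmin : ∀ t, p ≤ t → t ≤ r → φ p ≤ φ t) : 0 ≤ D := by
  have h1 := hasDerivWithinAt_iff_tendsto_slope' (s := Set.Ioi p) (by simp) |>.1
    (hφ.hasDerivWithinAt (s := Set.Ioi p))
  refine ge_of_tendsto h1 ?_
  filter_upwards [Ioo_mem_nhdsGT hpr] with t ht
  rw [slope_def_field]
  exact div_nonneg (by linarith [hmin t ht.1.le ht.2.le]) (by linarith [ht.1])

theorem deriv_nonpos_left (φ : ℝ → ℝ) (D p l : ℝ) (hφ : HasDerivAt φ D p) (hpl : l < p)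
    (hmin : ∀ t, l ≤ t → t ≤ p → φ p ≤ φ t) : D ≤ 0 := by
  have h1 := hasDerivWithinAt_iff_tendsto_slope' (s := Set.Iio p) (by simp) |>.1
    (hφ.hasDerivWithinAt (s := Set.Iio p))
  refine le_of_tendsto h1 ?_
  filter_upwards [Ioo_mem_nhdsLT hpl] with t ht
  rw [slope_def_field]
  exact div_nonpos_of_nonneg_of_nonpos (by linarith [hmin t ht.1.le ht.2.le]) (by linarith [ht.2])

/-- A stationary point of the potential on the box `[ε, 1]^n`. -/
theorem exists_stationary {n : ℕ} (c : Typ n → ℕ) (β : Fin n → ℝ) (ε : ℝ) (h0 : 0 < ε)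
    (h1 : ε < 1) (h : ℝ → ℝ) (hc : Continuous h) :
    ∃ a : Fin n → ℝ, (∀ i, ε ≤ a i ∧ a i ≤ 1) ∧
      (∀ i, a i < 1 → β i ≤ a i * ∑ R : Typ n, if i ∈ R.1 then c R * h (∑ j ∈ R.1, a j) else 0) ∧
      (∀ i, ε < a i →
        a i * (∑ R : Typ n, if i ∈ R.1 then c R * h (∑ j ∈ R.1, a j) else 0) ≤ β i) := by
  set Ψ : ℝ → ℝ := fun A => ∫ s in (0 : ℝ)..A, h s with hΨ
  have hΨd : ∀ A, HasDerivAt Ψ (h A) A := fun A =>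
    intervalIntegral.integral_hasDerivAt_right (hc.intervalIntegrable _ _)
      hc.stronglyMeasurable.stronglyMeasurableAtFilter hc.continuousAt
  have hΨc : Continuous Ψ := continuous_iff_continuousAt.2 fun A => (hΨd A).continuousAt
  set G : (Fin n → ℝ) → ℝ := fun a =>
    ∑ R : Typ n, (c R : ℝ) * Ψ (∑ j ∈ R.1, a j) - ∑ i, β i * Real.log (a i) with hG
  have hcpt : IsCompact (Set.Icc (fun _ => ε : Fin n → ℝ) (fun _ => 1)) := isCompact_Icc
  have hGc : ContinuousOn G (Set.Icc (fun _ => ε : Fin n → ℝ) (fun _ => 1)) := by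
    apply ContinuousOn.sub
    · apply Continuous.continuousOn
      refine continuous_finsetSum _ fun R _ => ?_
      exact continuous_const.mul (hΨc.comp (by fun_prop))
    · refine continuousOn_finsetSum _ fun i _ => ?_
      refine continuousOn_const.mul (ContinuousOn.log (by fun_prop) fun a ha => ?_)
      have := ha.1 i
      simp only at this
      linarith
  obtain ⟨a, ha, hmin⟩ := hcpt.exists_isMinOn ⟨fun _ => ε, by
    constructor
    · exact le_rfl
    · intro i; exact h1.le⟩ hGc
  have hab : ∀ i, ε ≤ a i ∧ a i ≤ 1 := fun i => ⟨ha.1 i, ha.2 i⟩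
  have key : ∀ i, ∃ φ : ℝ → ℝ,
      HasDerivAt φ ((∑ R : Typ n, if i ∈ R.1 then c R * h (∑ j ∈ R.1, a j) else 0) - β i / a i)
        (a i) ∧ ∀ t, ε ≤ t → t ≤ 1 → φ (a i) ≤ φ t := by
    intro i
    refine ⟨fun t => ∑ R : Typ n, (c R : ℝ) * Ψ ((∑ j ∈ R.1, a j) + if i ∈ R.1 then t - a i else 0)
      - ∑ j, β j * Real.log (if j = i then t else a j), ?_, ?_⟩
    · apply HasDerivAt.sub
      · refine HasDerivAt.fun_sum fun R _ => ?_
        by_cases hi : i ∈ R.1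
        · simp only [hi, if_true]
          refine HasDerivAt.const_mul _ ?_
          have e1 : HasDerivAt (fun t => (∑ j ∈ R.1, a j) + (t - a i)) 1 (a i) :=
            ((hasDerivAt_id (a i)).sub_const (a i)).const_add _
          have e2 : HasDerivAt Ψ (h (∑ j ∈ R.1, a j)) ((∑ j ∈ R.1, a j) + (a i - a i)) := by
            simpa using hΨd (∑ j ∈ R.1, a j)
          have e3 := e2.comp (a i) e1
          rw [mul_one] at e3
          exact e3
        · simp only [hi, if_false]
          exact hasDerivAt_const _ _
      · have e1 : HasDerivAt (fun t => ∑ j, β j * Real.log (if j = i then t else a j))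
            (∑ j, if j = i then β i / a i else 0) (a i) := by
          refine HasDerivAt.fun_sum fun j _ => ?_
          by_cases hj : j = i
          · subst hj
            simp only [if_true, div_eq_mul_inv]
            exact (Real.hasDerivAt_log (by linarith [(hab j).1])).const_mul _
          · simp only [hj, if_false]
            exact hasDerivAt_const _ _
        simpa using e1
    · have e : ∀ t, ∑ R : Typ n, (c R : ℝ) * Ψ ((∑ j ∈ R.1, a j) + if i ∈ R.1 then t - a i else 0)
          - ∑ j, β j * Real.log (if j = i then t else a j) = G (Function.update a i t) := by
        intro t
        simp only [hG]
        congr 1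
        · refine Finset.sum_congr rfl fun R _ => ?_
          congr 2
          by_cases hi : i ∈ R.1
          · rw [Finset.sum_update_of_mem hi, ← Finset.sum_sdiff (Finset.singleton_subset_iff.2 hi)]
            simp [hi]
            ring
          · rw [Finset.sum_update_of_notMem hi]
            simp [hi]
        · refine Finset.sum_congr rfl fun j _ => ?_
          rw [Function.update_apply]
      intro t ht0 ht1
      simp only [e, Function.update_eq_self]
      apply hmin
      constructor
      · intro j
        rw [Function.update_apply]
        split_ifs
        exacts [ht0, (hab j).1]
      · intro j
        rw [Function.update_apply]
        split_ifs
        exacts [ht1, (hab j).2]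
  refine ⟨a, hab, fun i hi => ?_, fun i hi => ?_⟩
  · obtain ⟨φ, hφ, hm⟩ := key i
    have := deriv_nonneg_right φ _ _ 1 hφ hi fun t ht ht' => hm t ((hab i).1.trans ht) ht'
    have hp : 0 < a i := by linarith [(hab i).1]
    rw [sub_nonneg, div_le_iff₀ hp] at this
    linarith
  · obtain ⟨φ, hφ, hm⟩ := key i
    have := deriv_nonpos_left φ _ _ ε hφ hi fun t ht ht' => hm t ht (ht'.trans (hab i).2)
    have hp : 0 < a i := by linarith [(hab i).1]
    rw [sub_nonpos, le_div_iff₀ hp] at this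
    linarith

theorem approx_core {n : ℕ} (c : Typ n → ℕ) (b : Fin n → ℝ) (hb : ∀ i, 0 ≤ b i) (ε : ℝ)
    (h0 : 0 < ε) (h1 : ε < 1 / 2) :
    ∃ x : Typ n → ℝ, (∀ R, 0 ≤ x R) ∧ (∀ R, x R ≤ c R) ∧
      ∑ R, x R ≤ (∑ i, b i + n * (ε * ∑ R, (c R : ℝ))) / (1 - ε) ∧
      ∀ (S : Finset (Fin n)) (y : Typ n → ℝ), S.Nonempty → (∀ R, 0 ≤ y R) → (∀ R, y R ≤ c R) →
        ∑ R, y R ≤ ∑ i ∈ S, b i → ¬ ∀ i ∈ S, fracUtil x i < fracUtil y i := by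
  obtain ⟨h, hc, hn0, hle1, heq1, hpos⟩ := exists_h ε h0 h1
  have hε : 0 < 1 - ε := by linarith
  obtain ⟨a, ha, hge, hle⟩ := exists_stationary c (fun i => b i / (1 - ε)) ε h0 (by linarith) h hc
  set A : Typ n → ℝ := fun R => ∑ j ∈ R.1, a j with hA
  have ha0 : ∀ i, 0 < a i := fun i => h0.trans_le (ha i).1
  have hA0 : ∀ R, 0 < A R := fun R => Finset.sum_pos (fun i _ => ha0 i) R.2
  have haA : ∀ i (R : Typ n), i ∈ R.1 → a i ≤ A R := fun i R hi =>
    Finset.single_le_sum (f := a) (fun j _ => (ha0 j).le) hi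
  have hhle : ∀ R, h (A R) ≤ 1 / (1 - ε) := by
    intro R
    rcases (hn0 (A R)).eq_or_lt with h2 | h2
    · rw [← h2]; positivity
    · rw [le_div_iff₀ hε]
      nlinarith [hpos _ h2, hle1 _ (hA0 R)]
  set s : Fin n → ℝ := fun i => a i * ∑ R : Typ n, if i ∈ R.1 then (c R : ℝ) * h (A R) else 0
    with hs
  refine ⟨fun R => c R * (A R * h (A R)), fun R => ?_, fun R => ?_, ?_, ?_⟩
  · have := hn0 (A R)
    have := hA0 R
    positivity
  · have := hle1 (A R) (hA0 R)
    have h3 : (0 : ℝ) ≤ c R := by positivity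
    nlinarith
  · have e1 : ∑ R : Typ n, (c R : ℝ) * (A R * h (A R)) = ∑ i, s i := by
      simp only [hs, Finset.mul_sum]
      rw [Finset.sum_comm]
      refine Finset.sum_congr rfl fun R _ => ?_
      have : A R = ∑ i, if i ∈ R.1 then a i else 0 := by
        rw [← Finset.sum_filter]; simp [hA]
      calc (c R : ℝ) * (A R * h (A R)) = (∑ i, if i ∈ R.1 then a i else 0) * (c R * h (A R)) := by
            rw [← this]; ring
        _ = _ := by
            rw [Finset.sum_mul]
            refine Finset.sum_congr rfl fun i _ => ?_
            split_ifs <;> simp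
    have e2 : ∀ i, s i ≤ (b i + ε * ∑ R, (c R : ℝ)) / (1 - ε) := by
      intro i
      have hC : 0 ≤ ε * ∑ R, (c R : ℝ) := by positivity
      by_cases hi : ε < a i
      · refine (hle i hi).trans ?_
        gcongr
        linarith
      · have hai : a i = ε := le_antisymm (not_lt.1 hi) (ha i).1
        have e3 : (∑ R : Typ n, if i ∈ R.1 then (c R : ℝ) * h (A R) else 0) ≤
            ∑ R : Typ n, (c R : ℝ) * (1 / (1 - ε)) := by
          refine Finset.sum_le_sum fun R _ => ?_
          have : (0 : ℝ) ≤ c R := by positivity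
          split_ifs
          · exact mul_le_mul_of_nonneg_left (hhle R) this
          · positivity
        rw [← Finset.sum_mul] at e3
        calc s i ≤ ε * ((∑ R : Typ n, (c R : ℝ)) * (1 / (1 - ε))) := by
              simp only [hs, hai]; exact mul_le_mul_of_nonneg_left e3 h0.le
          _ = (0 + ε * ∑ R, (c R : ℝ)) / (1 - ε) := by ring
          _ ≤ _ := by gcongr; exact hb i
    rw [e1]
    refine (Finset.sum_le_sum fun i _ => e2 i).trans (le_of_eq ?_)
    rw [← Finset.sum_div, Finset.sum_add_distrib]
    simp
  · intro S y hS hy0 hyc hyb hall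
    have hmax : ∀ R, 0 < max 1 (A R) := fun R => lt_max_of_lt_left one_pos
    have hx1 : ∀ R, 1 ≤ A R → (c R : ℝ) * (A R * h (A R)) = c R := fun R hR => by
      rw [heq1 _ hR, mul_one]
    have e1 : ∀ i ∈ S, b i < ∑ R : Typ n, if i ∈ R.1 then a i / max 1 (A R) * y R else 0 := by
      intro i hi
      have hu := hall i hi
      unfold fracUtil at hu
      beta_reduce at hu
      have hai : a i < 1 := by
        by_contra hge1
        apply absurd hu (not_lt.2 _)
        refine Finset.sum_le_sum fun R _ => ?_
        split_ifs with hR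
        · rw [hx1 R ((not_lt.1 hge1).trans (haA i R hR))]; exact hyc R
        · exact le_rfl
      have hsi : b i / (1 - ε) ≤ s i := hge i hai
      rw [div_le_iff₀ hε] at hsi
      have e2 : s i * (1 - ε) ≤ ∑ R : Typ n,
          if i ∈ R.1 then a i / max 1 (A R) * (c R * (A R * h (A R))) else 0 := by
        simp only [hs]
        rw [Finset.mul_sum, Finset.sum_mul]
        refine Finset.sum_le_sum fun R _ => ?_
        split_ifs with hR
        · have e3 : h (A R) * (1 - ε) ≤ A R * h (A R) / max 1 (A R) := by
            rw [le_div_iff₀ (hmax R)]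
            rcases (hn0 (A R)).eq_or_lt with h2 | h2
            · rw [← h2]; simp
            · have h3 := hpos _ h2
              rcases le_total 1 (A R) with h4 | h4
              · rw [max_eq_right h4]
                nlinarith [mul_pos h2 (hA0 R)]
              · rw [max_eq_left h4]
                nlinarith
          have h5 : 0 ≤ a i * c R := mul_nonneg (ha0 i).le (by positivity)
          calc a i * (c R * h (A R)) * (1 - ε) = (a i * c R) * (h (A R) * (1 - ε)) := by ring
            _ ≤ (a i * c R) * (A R * h (A R) / max 1 (A R)) := mul_le_mul_of_nonneg_left e3 h5
            _ = _ := by ring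
        · simp
      have e4 : a i * ((∑ R : Typ n, if i ∈ R.1 then y R else 0) -
          ∑ R : Typ n, if i ∈ R.1 then (c R : ℝ) * (A R * h (A R)) else 0) ≤
          (∑ R : Typ n, if i ∈ R.1 then a i / max 1 (A R) * y R else 0) -
          ∑ R : Typ n, if i ∈ R.1 then a i / max 1 (A R) * (c R * (A R * h (A R))) else 0 := by
        rw [← Finset.sum_sub_distrib, ← Finset.sum_sub_distrib, Finset.mul_sum]
        refine Finset.sum_le_sum fun R _ => ?_
        split_ifs with hR
        · rw [← mul_sub]
          rcases le_total 1 (A R) with h4 | h4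
          · have h5 : a i / max 1 (A R) ≤ a i := div_le_self (ha0 i).le (le_max_left _ _)
            have h6 : y R - c R * (A R * h (A R)) ≤ 0 := by
              rw [hx1 R h4]; linarith [hyc R]
            exact mul_le_mul_of_nonpos_right h5 h6
          · rw [max_eq_left h4, div_one]
        · simp
      have e5 := mul_pos (ha0 i) (sub_pos.2 hu)
      linarith
    have e6 := Finset.sum_lt_sum_of_nonempty hS e1
    have e7 : ∑ i ∈ S, ∑ R : Typ n, (if i ∈ R.1 then a i / max 1 (A R) * y R else 0) ≤
        ∑ R, y R := by
      rw [Finset.sum_comm]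
      refine Finset.sum_le_sum fun R _ => ?_
      have e8 : ∑ i ∈ S, (if i ∈ R.1 then a i / max 1 (A R) * y R else 0) ≤
          ∑ i, (if i ∈ R.1 then a i / max 1 (A R) * y R else 0) := by
        refine Finset.sum_le_sum_of_subset_of_nonneg (Finset.subset_univ _) fun i _ _ => ?_
        split_ifs
        · exact mul_nonneg (div_nonneg (ha0 i).le (hmax R).le) (hy0 R)
        · exact le_rfl
      refine e8.trans ?_
      rw [← Finset.sum_filter, ← Finset.sum_mul, ← Finset.sum_div]
      have e9 : (∑ i ∈ Finset.univ.filter (fun i => i ∈ R.1), a i) = A R := by simp [hA]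
      rw [e9]
      have : A R / max 1 (A R) ≤ 1 := (div_le_one (hmax R)).2 (le_max_right _ _)
      nlinarith [hy0 R]
    linarith

theorem continuous_fracUtil {n : ℕ} (i : Fin n) : Continuous (fun x : Typ n → ℝ => fracUtil x i) := by
  unfold fracUtil
  refine continuous_finsetSum _ fun R _ => ?_
  split_ifs <;> fun_prop

theorem fracCore_nonempty {n : ℕ} (c : Typ n → ℕ) (k : ℕ) (b : Fin n → ℚ)
    (hb : ∀ i, 0 ≤ b i) (hsum : (∑ i, b i) = (k : ℚ)) : FracCoreNonempty c k b := by
  have hsum' : ∑ i, (b i : ℝ) = k := by exact_mod_cast congrArg (fun q : ℚ => (q : ℝ)) hsum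
  set e : ℕ → ℝ := fun m => 1 / ((m : ℝ) + 3) with he
  have he0 : ∀ m, 0 < e m := fun m => by simp only [he]; positivity
  have he1 : ∀ m, e m < 1 / 2 := fun m => by
    simp only [he]
    apply one_div_lt_one_div_of_lt (by norm_num)
    have : (0 : ℝ) ≤ m := by positivity
    linarith
  have hlim : Filter.Tendsto e Filter.atTop (nhds 0) := by
    have := (tendsto_one_div_add_atTop_nhds_zero_nat (𝕜 := ℝ)).comp (Filter.tendsto_add_atTop_nat 2)
    refine this.congr fun m => ?_
    simp only [Function.comp, he]
    push_cast
    ring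
  choose x hx0 hxc hxs hxb using fun m =>
    approx_core c (fun i => (b i : ℝ)) (fun i => by exact_mod_cast hb i) (e m) (he0 m) (he1 m)
  have hcpt : IsCompact (Set.Icc (fun _ => 0 : Typ n → ℝ) (fun R => (c R : ℝ))) := isCompact_Icc
  obtain ⟨z, hz, φ, hφ, hlimz⟩ := hcpt.tendsto_subseq (x := x) fun m => ⟨hx0 m, hxc m⟩
  refine ⟨z, ⟨hz.1, hz.2, ?_⟩, ?_⟩
  · have l1 : Filter.Tendsto (fun m => ∑ R, x (φ m) R) Filter.atTop (nhds (∑ R, z R)) :=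
      ((continuous_finsetSum Finset.univ fun R _ => continuous_apply R).tendsto z).comp hlimz
    have l2 : Filter.Tendsto (fun m => (∑ i, (b i : ℝ) + n * (e (φ m) * ∑ R, (c R : ℝ))) / (1 - e (φ m)))
        Filter.atTop (nhds ((∑ i, (b i : ℝ) + n * (0 * ∑ R, (c R : ℝ))) / (1 - 0))) := by
      have l3 := hlim.comp hφ.tendsto_atTop
      exact (((l3.mul_const _).const_mul _).const_add _).div (l3.const_sub 1) (by norm_num)
    have := le_of_tendsto_of_tendsto' l1 l2 fun m => hxs (φ m)
    rw [hsum'] at this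
    simpa using this
  · rintro ⟨S, y, hS, ⟨hy0, hyc, hyb⟩, hall⟩
    have hev : ∀ᶠ m in Filter.atTop, ∀ i ∈ S, fracUtil (x (φ m)) i < fracUtil y i := by
      rw [Finset.eventually_all]
      intro i hi
      exact (((continuous_fracUtil i).tendsto z).comp hlimz).eventually_lt_const (hall i hi)
    obtain ⟨m, hm⟩ := hev.exists
    refine hxb (φ m) S y hS hy0 hyc ?_ hm
    simpa using hyb

theorem fracUtil_cast {n : ℕ} (y : Typ n → ℕ) (i : Fin n) :
    fracUtil (fun R => (y R : ℝ)) i = (intUtil y i : ℝ) := by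
  unfold fracUtil intUtil
  push_cast
  rfl

/-- For `n ≤ 5` voters, the core of every instance `(c, k, b)` with non-negative
rational budgets summing to `k` is non-empty. -/
theorem stmt15 (n : ℕ) (hn : n ≤ 5) (c : Typ n → ℕ) (k : ℕ) (b : Fin n → ℚ)
    (hb : ∀ i, 0 ≤ b i) (hsum : (∑ i, b i) = (k : ℚ)) :
    ∃ x : Typ n → ℕ, InCore c k b x := by
  obtain ⟨x, hx, hcore⟩ := fracCore_nonempty c k b hb hsum
  obtain ⟨z, hz, hu⟩ := integralizable_of_le_five hn c k (fun i => ⌊fracUtil x i⌋)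
    ⟨x, hx, fun i => Int.floor_le _⟩
  refine ⟨z, hz, ?_⟩
  rintro ⟨S, y, hS, ⟨hyc, hyb⟩, hall⟩
  refine hcore ⟨S, fun R => (y R : ℝ), hS, ⟨fun R => by positivity, fun R => by simpa using hyc R, ?_⟩, ?_⟩
  · beta_reduce
    exact_mod_cast hyb
  · intro i hi
    rw [fracUtil_cast]
    exact Int.floor_lt.1 ((hu i).trans_lt (hall i hi))
end
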